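/- arXiv:0903.0369 — 2 statements merged into one kernel-verified Lean document; each statement's English description precedes it below -/
import Mathlib

section
/- Let f be a homeomorphism of the open unit disk 𝔻, let n ≥ 1 be an integer, and for each i ∈ ℤ/nℤ let Γ_i : ℝ → 𝔻 be a continuous map with Γ_i(t) → α_i as t → −∞ and Γ_i(t) → ω_i as t → +∞, where the 2n points α_i, ω_i ∈ S¹ are pairwise distinct. Assume that f(Γ_i(t)) ≠ Γ_i(t') whenever t' ≤ t. For each i, let (t_i^l)_{l∈ℤ} be a strictly increasing sequence of real numbers with t_i^l → −∞ as l → −∞ and t_i^l → +∞ as l → +∞, and assume that Γ_i([t_i^1, +∞)) ∩ Γ_{i'}(ℝ) = ∅ for every i' ≠ i, and that Γ_i([t_i^1, +∞)) ∩ Γ_i((−∞, t_i^0]) = ∅. Then there exists a family (V_i^l)_{i∈ℤ/nℤ, l∈ℤ∖{0}} of open disks in 𝔻 such that: Γ_i([t_i^l, t_i^{l+1}]) ⊆ V_i^l for every l ≠ 0; V_i^l ∩ V_{i'}^{l'} = ∅ whenever i ≠ i' and l > 0; V_i^l ∩ V_i^{l'} = ∅ whenever l' < 0 < l; f(V_i^l)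 ∩ V_i^{l'} = ∅ whenever l' < l (l, l' ≠ 0); the closures (cl(V_i^l))_{l>0} converge to {ω_i} as l → +∞; and the closures (cl(V_i^l))_{l<0} converge to {α_i} as l → −∞. (Lemma 6.1.) -/
open Set Filter Metric Topology

noncomputable section

/-- The open unit disk in the complex plane. -/
abbrev Disk : Set ℂ := Metric.ball 0 1

/-- The `k`-th iterate (`k ∈ ℤ`) of a homeomorphism of the open unit disk. -/
def fiter (f : ↥Disk ≃ₜ ↥Disk) (k : ℤ) : ↥Disk → ↥Disk := fun z => (f.toEquiv ^ k) z

/-- A subset `X` of the disk is free for `f` if `f(X) ∩ X = ∅`. -/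
def IsFreeSet (f : ↥Disk ≃ₜ ↥Disk) (X : Set ↥Disk) : Prop := (⇑f '' X) ∩ X = ∅

/-- An open disk: an open subset of `Disk` homeomorphic to `Disk`. -/
def IsOpenDisk (U : Set ↥Disk) : Prop := IsOpen U ∧ Nonempty (↥U ≃ₜ ↥Disk)

/-- `f` is recurrent: there is a closed chain of pairwise disjoint free open disks. -/
def RecurrentHomeo (f : ↥Disk ≃ₜ ↥Disk) : Prop :=
  ∃ r : ℕ, 1 ≤ r ∧ ∃ X : ZMod r → Set ↥Disk,
    (∀ i, IsOpenDisk (X i)) ∧ (∀ i, IsFreeSet f (X i)) ∧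
    (Pairwise fun i j => Disjoint (X i) (X j)) ∧
    (∀ i, ∃ k : ℤ, 1 ≤ k ∧ ((fiter f k '' X i) ∩ X (i + 1)).Nonempty)

/-- Every continuous nonvanishing function on `V` has a continuous logarithm. -/
def HasLog (V : Set ℂ) : Prop := ∀ g : ℂ → ℂ, ContinuousOn g V → (∀ z ∈ V, g z ≠ 0) →
  ∃ h : ℂ → ℂ, ContinuousOn h V ∧ ∀ z ∈ V, Complex.exp (h z) = g z

lemma HasLog.sqrt {V : Set ℂ} (hV : IsOpen V) (hL : HasLog V) {g : ℂ → ℂ}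
    (hg : DifferentiableOn ℂ g V) (h0 : ∀ z ∈ V, g z ≠ 0) :
    ∃ s : ℂ → ℂ, DifferentiableOn ℂ s V ∧ ∀ z ∈ V, s z ^ 2 = g z := by
  obtain ⟨h, hc, he⟩ := hL g hg.continuousOn h0
  have hsq : ∀ z ∈ V, Complex.exp (h z / 2) ^ 2 = g z := by
    intro z hz
    rw [← Complex.exp_nat_mul, ← he z hz]
    congr 1; push_cast; ring
  refine ⟨fun z => Complex.exp (h z / 2), ?_, hsq⟩
  set s : ℂ → ℂ := fun z => Complex.exp (h z / 2) with hs
  have hsc : ContinuousOn s V := by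
    apply Complex.continuous_exp.comp_continuousOn
    exact hc.div_const 2
  intro z hz
  have hVz := hV.mem_nhds hz
  have hsz : s z ≠ 0 := Complex.exp_ne_zero _
  have hgd : HasDerivAt g (deriv g z) z := ((hg z hz).differentiableAt hVz).hasDerivAt
  have hsca : ContinuousAt s z := hsc.continuousAt hVz
  have : HasDerivAt s (deriv g z / (s z + s z)) z := by
    rw [hasDerivAt_iff_tendsto_slope] at hgd ⊢
    have h1 : Tendsto (fun w => slope g z w / (s w + s z)) (𝓝[≠] z)
        (𝓝 (deriv g z / (s z + s z))) := by
      apply hgd.div ((hsca.tendsto.mono_left nhdsWithin_le_nhds).add_const _)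
      rw [← two_mul]; exact mul_ne_zero two_ne_zero hsz
    refine h1.congr' ?_
    have hne : ∀ᶠ w in 𝓝[≠] z, s w + s z ≠ 0 := by
      apply ((hsca.tendsto.mono_left nhdsWithin_le_nhds).add_const (s z)).eventually_ne
      rw [← two_mul]; exact mul_ne_zero two_ne_zero hsz
    filter_upwards [hne, nhdsWithin_le_nhds hVz, self_mem_nhdsWithin] with w hw hwV hwz
    rw [slope_def_field, slope_def_field, ← hsq w hwV, ← hsq z hz]
    have : w - z ≠ 0 := sub_ne_zero.2 hwz
    change (s w ^ 2 - s z ^ 2) / (w - z) / (s w + s z) = (s w - s z) / (w - z)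
    field_simp
    ring
  exact this.differentiableAt.differentiableWithinAt

lemma montel_aux {V : Set ℂ} (hV : IsOpen V) (F : ℕ → ℂ → ℂ)
    (hF : ∀ n, DifferentiableOn ℂ (F n) V) (hb : ∀ n, MapsTo (F n) V (ball 0 1)) :
    ∃ f : ℂ → ℂ, TendstoLocallyUniformlyOn F f (hyperfilter ℕ : Filter ℕ) V := by
  have hpt : ∀ z : ℂ, ∃ w, z ∈ V → Tendsto (fun n => F n z) (hyperfilter ℕ : Filter ℕ) (𝓝 w) := by
    intro z
    by_cases hz : z ∈ V
    · have := (isCompact_closedBall (0 : ℂ) 1).ultrafilter_le_nhds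
        ((hyperfilter ℕ).map (fun n => F n z)) (by
          rw [le_principal_iff]
          exact Filter.mem_map.2 (mem_of_superset univ_mem
            (fun n _ => ball_subset_closedBall (hb n hz))))
      obtain ⟨w, -, hw⟩ := this
      exact ⟨w, fun _ => hw⟩
    · exact ⟨0, fun h => absurd h hz⟩
  choose f hf using hpt
  refine ⟨f, ?_⟩
  rw [Metric.tendstoLocallyUniformlyOn_iff]
  intro ε hε x hx
  obtain ⟨ρ, hρ, hρV⟩ := Metric.isOpen_iff.1 hV x hx
  have hlip : ∀ n, ∀ y ∈ ball x ρ, dist (F n y) (F n x) ≤ 2 / ρ * dist y x := by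
    intro n y hy
    apply Complex.dist_le_div_mul_dist_of_mapsTo_ball ((hF n).mono hρV) _ hy
    intro u hu
    have h1 := hb n (hρV hu)
    have h2 := hb n hx
    rw [mem_ball_zero_iff] at h1 h2
    rw [mem_closedBall, dist_eq_norm]
    linarith [norm_sub_le (F n u) (F n x)]
  have hlip' : ∀ y ∈ ball x ρ, dist (f y) (f x) ≤ 2 / ρ * dist y x := by
    intro y hy
    exact le_of_tendsto ((hf y (hρV hy)).dist (hf x hx)) (Eventually.of_forall fun n => hlip n y hy)
  have hδ : 0 < min ρ (ρ * ε / 8) := by positivity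
  refine ⟨ball x (min ρ (ρ * ε / 8)), nhdsWithin_le_nhds (ball_mem_nhds x hδ), ?_⟩
  have := Metric.tendsto_nhds.1 (hf x hx) (ε / 4) (by positivity)
  filter_upwards [this] with n hn y hy
  have hy1 : y ∈ ball x ρ := ball_subset_ball (min_le_left _ _) hy
  have hy2 : dist y x < ρ * ε / 8 := lt_of_lt_of_le hy (min_le_right _ _)
  have h3 : 2 / ρ * dist y x < ε / 4 := by
    calc 2 / ρ * dist y x < 2 / ρ * (ρ * ε / 8) := by gcongr
      _ = ε / 4 := by field_simp; ring
  have h4 := hlip n y hy1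
  have h5 := hlip' y hy1
  have h6 := dist_triangle4 (f y) (f x) (F n x) (F n y)
  rw [dist_comm (f x) (F n x), dist_comm (F n x) (F n y)] at h6
  linarith

lemma hurwitz_aux {V : Set ℂ} (hV : IsOpen V) (hc : IsPreconnected V) {φ : Filter ℕ} [φ.NeBot]
    (F : ℕ → ℂ → ℂ) (f : ℂ → ℂ) (hF : ∀ n, DifferentiableOn ℂ (F n) V)
    (hinj : ∀ n, InjOn (F n) V) (hf : TendstoLocallyUniformlyOn F f φ V)
    {z₀ : ℂ} (hz₀ : z₀ ∈ V) (hd : deriv f z₀ ≠ 0) : InjOn f V := by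
  have hfd : DifferentiableOn ℂ f V := hf.differentiableOn (Eventually.of_forall hF) hV
  have hfa : AnalyticOnNhd ℂ f V := hfd.analyticOnNhd hV
  intro a ha b hb hab
  by_contra hne
  have hiso : ∀ᶠ z in 𝓝[≠] a, f z - f a ≠ 0 := by
    rcases ((hfa a ha).sub (analyticAt_const (v := f a))).eventually_eq_zero_or_eventually_ne_zero
      with h | h
    · exfalso
      have : EqOn f (fun _ => f a) V :=
        hfa.eqOn_of_preconnected_of_eventuallyEq analyticOnNhd_const hc ha
          (h.mono fun z hz => sub_eq_zero.1 hz)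
      apply hd
      have h2 : f =ᶠ[𝓝 z₀] fun _ => f a := by
        filter_upwards [hV.mem_nhds hz₀] with z hz using this hz
      rw [h2.deriv_eq]; simp
    · exact h
  rw [eventually_nhdsWithin_iff] at hiso
  obtain ⟨r₁, hr₁, hr₁'⟩ := Metric.eventually_nhds_iff.1 hiso
  obtain ⟨r₂, hr₂, hr₂'⟩ := Metric.isOpen_iff.1 hV a ha
  have hdab : 0 < dist a b := dist_pos.2 hne
  set r := min (min r₁ r₂) (dist a b) / 2 with hr
  have hrpos : 0 < r := by positivity
  have hm0 : min (min r₁ r₂) (dist a b) ≤ r₁ := (min_le_left _ _).trans (min_le_left _ _)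
  have hm1 : min (min r₁ r₂) (dist a b) ≤ r₂ := (min_le_left _ _).trans (min_le_right _ _)
  have hm2 : min (min r₁ r₂) (dist a b) ≤ dist a b := min_le_right _ _
  have hsub : closedBall a r ⊆ V := by
    refine Subset.trans (closedBall_subset_ball ?_) hr₂'
    linarith
  have hsph : ∀ z ∈ sphere a r, f z - f a ≠ 0 := by
    intro z hz
    rw [mem_sphere] at hz
    refine hr₁' (by linarith) ?_
    intro h
    rw [mem_singleton_iff] at h
    rw [h, dist_self] at hz; linarith
  obtain ⟨m, hm, hmle⟩ : ∃ m > 0, ∀ z ∈ sphere a r, m ≤ ‖f z - f a‖ := by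
    obtain ⟨x, hx, hx'⟩ := (isCompact_sphere a r).exists_isMinOn
      (NormedSpace.sphere_nonempty.2 hrpos.le)
      (f := fun z => ‖f z - f a‖)
      (((hfd.continuousOn.mono (sphere_subset_closedBall.trans hsub)).sub
        continuousOn_const).norm)
    exact ⟨_, norm_pos_iff.2 (hsph x hx), fun z hz => hx' hz⟩
  have hunif : TendstoUniformlyOn F f φ (closedBall a r) :=
    (tendstoLocallyUniformlyOn_iff_forall_isCompact hV).1 hf _ hsub (isCompact_closedBall a r)
  have e1 := Metric.tendstoUniformlyOn_iff.1 hunif (m / 8) (by positivity)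
  have e2 := Metric.tendsto_nhds.1 (hf.tendsto_at hb) (m / 8) (by positivity)
  obtain ⟨n, hn1, hn2⟩ := (e1.and e2).exists
  have haa : a ∈ closedBall a r := mem_closedBall_self hrpos.le
  have hball := DiffContOnCl.ball_subset_image_closedBall (f := F n) (z₀ := a) (r := r)
    (ε := m / 2)
    (((hF n).mono hsub).diffContOnCl_ball Subset.rfl) hrpos (by
      intro z hz
      have h1 := hn1 z (sphere_subset_closedBall hz)
      have h2 := hn1 a haa
      have h3 := hmle z hz
      rw [← dist_eq_norm] at h3 ⊢
      have h6 := dist_triangle4 (f z) (F n z) (F n a) (f a)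
      rw [dist_comm (F n a) (f a)] at h6
      linarith) (by
      have : ∀ᶠ z in 𝓝[≠] a, F n z ≠ F n a := by
        filter_upwards [nhdsWithin_le_nhds (hV.mem_nhds ha), self_mem_nhdsWithin] with z hz hza h
        exact hza (hinj n hz ha h)
      exact this.frequently.filter_mono nhdsWithin_le_nhds)
  have hmem : F n b ∈ ball (F n a) (m / 2 / 2) := by
    rw [mem_ball]
    have h2 := hn1 a haa
    have h6 := dist_triangle4 (F n b) (f b) (f a) (F n a)
    rw [← hab, dist_self] at h6
    rw [← hab] at hn2
    linarith
  obtain ⟨z, hz, hzb⟩ := hball hmem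
  have : z = b := hinj n (hsub hz) hb hzb
  rw [this, mem_closedBall, dist_comm] at hz
  linarith

lemma mob_facts {w u : ℂ} (hw : ‖w‖ < 1) (hu : ‖u‖ < 1) :
    1 - (starRingEnd ℂ) w * u ≠ 0 ∧ ‖(u - w) / (1 - (starRingEnd ℂ) w * u)‖ < 1 := by
  have h1 : 1 - (starRingEnd ℂ) w * u ≠ 0 := by
    intro h
    have : ‖(starRingEnd ℂ) w * u‖ = 1 := by
      rw [← sub_eq_zero.1 h]; simp
    rw [norm_mul, RCLike.norm_conj] at this
    nlinarith [norm_nonneg w, norm_nonneg u]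
  refine ⟨h1, ?_⟩
  rw [norm_div, div_lt_one (norm_pos_iff.2 h1)]
  rw [← sq_lt_sq₀ (norm_nonneg _) (norm_nonneg _)]
  have ha : ‖w‖ ^ 2 < 1 := by nlinarith [norm_nonneg w]
  have hb : ‖u‖ ^ 2 < 1 := by nlinarith [norm_nonneg u]
  rw [← Complex.normSq_eq_norm_sq] at *
  rw [← Complex.normSq_eq_norm_sq]
  simp only [Complex.normSq_apply, Complex.sub_re, Complex.sub_im, Complex.mul_re, Complex.mul_im,
    Complex.one_re, Complex.one_im, Complex.conj_re, Complex.conj_im] at *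
  nlinarith [mul_pos (sub_pos.2 ha) (sub_pos.2 hb)]

lemma mob_hasDerivAt {w u : ℂ} (h : 1 - (starRingEnd ℂ) w * u ≠ 0) :
    HasDerivAt (fun u => (u - w) / (1 - (starRingEnd ℂ) w * u))
      ((1 - (starRingEnd ℂ) w * w) / (1 - (starRingEnd ℂ) w * u) ^ 2) u := by
  have h1 : HasDerivAt (fun u : ℂ => u - w) 1 u := (hasDerivAt_id u).sub_const w
  have h2 : HasDerivAt (fun u : ℂ => 1 - (starRingEnd ℂ) w * u) (-((starRingEnd ℂ) w)) u := by
    have := ((hasDerivAt_id u).const_mul ((starRingEnd ℂ) w)).const_sub 1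
    simpa using this
  have h3 := h1.div h2 h
  have h4 : (1 * (1 - (starRingEnd ℂ) w * u) - (u - w) * (-((starRingEnd ℂ) w))) =
    1 - (starRingEnd ℂ) w * w := by ring
  rw [h4] at h3
  exact h3

lemma mob_inj {w u v : ℂ} (hw : ‖w‖ < 1) (hu : ‖u‖ < 1) (hv : ‖v‖ < 1)
    (h : (u - w) / (1 - (starRingEnd ℂ) w * u) = (v - w) / (1 - (starRingEnd ℂ) w * v)) :
    u = v := by
  rw [div_eq_div_iff (mob_facts hw hu).1 (mob_facts hw hv).1] at h
  have h1 : (1 - (starRingEnd ℂ) w * w) * (u - v) = 0 := by linear_combination h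
  rcases mul_eq_zero.1 h1 with h2 | h2
  · exact absurd h2 (mob_facts hw hw).1
  · exact sub_eq_zero.1 h2

/-- Riemann mapping theorem for bounded domains with logarithms. -/
theorem riemann_map {V : Set ℂ} (hV : IsOpen V) (hc : IsPreconnected V) (hne : V.Nonempty)
    (hbd : Bornology.IsBounded V) (hL : HasLog V) : Nonempty (↥V ≃ₜ ↥Disk) := by
  obtain ⟨z₀, hz₀⟩ := hne
  let P : (ℂ → ℂ) → Prop := fun f => DifferentiableOn ℂ f V ∧ InjOn f V ∧ MapsTo f V (ball 0 1) ∧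
    f z₀ = 0
  let S : Set ℝ := {x | ∃ f, P f ∧ ‖deriv f z₀‖ = x}
  obtain ⟨ρ, hρ, hρV⟩ := Metric.isOpen_iff.1 hV z₀ hz₀
  have hSb : BddAbove S := by
    refine ⟨1 / ρ, ?_⟩
    rintro x ⟨f, ⟨h1, -, h3, h4⟩, rfl⟩
    apply Complex.norm_deriv_le_div_of_mapsTo_ball (h1.mono hρV) _ hρ
    rw [h4]
    exact fun z hz => ball_subset_closedBall (h3 (hρV hz))
  obtain ⟨R, hR⟩ := hbd.subset_ball 0
  have hRpos : 0 < R := by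
    have := hR hz₀
    rw [mem_ball_zero_iff] at this
    linarith [norm_nonneg z₀]
  have hRC : (2 * (R : ℂ)) ≠ 0 := by
    have : (R : ℂ) ≠ 0 := by exact_mod_cast hRpos.ne'
    simpa using this
  have hder0 : HasDerivAt (fun z : ℂ => (z - z₀) / (2 * (R : ℂ))) (1 / (2 * (R : ℂ))) z₀ :=
    ((hasDerivAt_id z₀).sub_const z₀).div_const _
  have hin : ‖(1 / (2 * (R : ℂ)))‖ ∈ S := by
    refine ⟨fun z => (z - z₀) / (2 * (R : ℂ)), ⟨?_, ?_, ?_, by simp⟩, by rw [hder0.deriv]⟩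
    · exact ((differentiable_id.sub_const z₀).div_const _).differentiableOn
    · intro a _ b _ hab
      simp only [div_left_inj' hRC] at hab
      exact sub_left_inj.1 hab
    · intro z hz
      have h1 := hR hz
      have h2 := hR hz₀
      rw [mem_ball_zero_iff] at h1 h2 ⊢
      have : ‖2 * (R : ℂ)‖ = 2 * R := by simp [abs_of_pos hRpos]
      rw [norm_div, this, div_lt_one (by positivity)]
      linarith [norm_sub_le z z₀]
  set M := sSup S with hM
  have hMpos : 0 < M := lt_of_lt_of_le (norm_pos_iff.2 (by simpa using hRC)) (le_csSup hSb hin)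
  obtain ⟨u, -, hu, huS⟩ := exists_seq_tendsto_sSup ⟨_, hin⟩ hSb
  choose F hF hFu using huS
  obtain ⟨f, hf⟩ := montel_aux hV F (fun n => (hF n).1) (fun n => (hF n).2.2.1)
  have hFd : ∀ᶠ n in (hyperfilter ℕ : Filter ℕ), DifferentiableOn ℂ (F n) V :=
    Eventually.of_forall fun n => (hF n).1
  have hfd : DifferentiableOn ℂ f V := hf.differentiableOn hFd hV
  have hfM : ‖deriv f z₀‖ = M := by
    have h1 := ((hf.deriv hFd hV).tendsto_at hz₀).norm
    have h2 : Tendsto u (hyperfilter ℕ : Filter ℕ) (𝓝 M) :=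
      hu.mono_left (by rw [← Nat.cofinite_eq_atTop]; exact hyperfilter_le_cofinite)
    refine tendsto_nhds_unique h1 (h2.congr fun n => ?_)
    exact (hFu n).symm
  have hd0 : deriv f z₀ ≠ 0 := by
    rw [← norm_pos_iff, hfM]; exact hMpos
  have hinj : InjOn f V := hurwitz_aux hV hc F f (fun n => (hF n).1) (fun n => (hF n).2.1) hf hz₀ hd0
  have hfa : AnalyticOnNhd ℂ f V := hfd.analyticOnNhd hV
  have hopen : ∀ s ⊆ V, IsOpen s → IsOpen (f '' s) := by
    rcases hfa.is_constant_or_isOpen hc with ⟨w, hw⟩ | h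
    · exfalso
      apply hd0
      have h2 : f =ᶠ[𝓝 z₀] fun _ => w := by
        filter_upwards [hV.mem_nhds hz₀] with z hz using hw z hz
      rw [h2.deriv_eq]; simp
    · exact h
  have hmaps : MapsTo f V (ball 0 1) := by
    have h1 : f '' V ⊆ closedBall 0 1 := by
      rintro _ ⟨z, hz, rfl⟩
      refine isClosed_closedBall.mem_of_tendsto (hf.tendsto_at hz) (Eventually.of_forall fun n => ?_)
      exact ball_subset_closedBall ((hF n).2.2.1 hz)
    have h2 : f '' V ⊆ interior (closedBall 0 1) := interior_maximal h1 (hopen V Subset.rfl hV)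
    rw [interior_closedBall _ one_ne_zero] at h2
    exact fun z hz => h2 ⟨z, hz, rfl⟩
  have hf0 : f z₀ = 0 := by
    have h1 := hf.tendsto_at hz₀
    have h2 : (fun n => F n z₀) = fun _ => 0 := funext fun n => (hF n).2.2.2
    rw [h2] at h1
    exact tendsto_nhds_unique h1 tendsto_const_nhds
  have hsurj : SurjOn f V (ball 0 1) := by
    intro w hw
    by_contra hnot
    rw [mem_ball_zero_iff] at hw
    have hfw : ∀ z ∈ V, f z ≠ w := fun z hz h => hnot ⟨z, hz, h⟩
    have hw0 : w ≠ 0 := fun h => hfw z₀ hz₀ (by rw [hf0, h])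
    have hfn : ∀ z ∈ V, ‖f z‖ < 1 := fun z hz => mem_ball_zero_iff.1 (hmaps hz)
    let g : ℂ → ℂ := fun z => (f z - w) / (1 - (starRingEnd ℂ) w * f z)
    have hgd : ∀ z ∈ V, HasDerivAt g ((1 - (starRingEnd ℂ) w * w) /
        (1 - (starRingEnd ℂ) w * f z) ^ 2 * deriv f z) z := by
      intro z hz
      exact (mob_hasDerivAt (mob_facts hw (hfn z hz)).1).comp z
        ((hfd z hz).differentiableAt (hV.mem_nhds hz)).hasDerivAt
    have hgD : DifferentiableOn ℂ g V :=
      fun z hz => (hgd z hz).differentiableAt.differentiableWithinAt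
    have hg0 : ∀ z ∈ V, g z ≠ 0 := by
      intro z hz
      exact div_ne_zero (sub_ne_zero.2 (hfw z hz)) (mob_facts hw (hfn z hz)).1
    obtain ⟨s, hsD, hs⟩ := hL.sqrt hV hgD hg0
    have hsn : ∀ z ∈ V, ‖s z‖ < 1 := by
      intro z hz
      have h1 : ‖g z‖ < 1 := (mob_facts hw (hfn z hz)).2
      rw [← hs z hz, norm_pow] at h1
      by_contra h
      push Not at h
      nlinarith
    have hsinj : InjOn s V := by
      intro a ha b hb hab
      apply hinj ha hb
      apply mob_inj hw (hfn a ha) (hfn b hb)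
      change g a = g b
      rw [← hs a ha, ← hs b hb, hab]
    set b := s z₀ with hb
    have hbn : ‖b‖ < 1 := hsn z₀ hz₀
    let G : ℂ → ℂ := fun z => (s z - b) / (1 - (starRingEnd ℂ) b * s z)
    have hGd : ∀ z ∈ V, HasDerivAt G ((1 - (starRingEnd ℂ) b * b) /
        (1 - (starRingEnd ℂ) b * s z) ^ 2 * deriv s z) z := by
      intro z hz
      exact (mob_hasDerivAt (mob_facts hbn (hsn z hz)).1).comp z
        ((hsD z hz).differentiableAt (hV.mem_nhds hz)).hasDerivAt
    have hPG : P G := by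
      refine ⟨fun z hz => (hGd z hz).differentiableAt.differentiableWithinAt, ?_, ?_, ?_⟩
      · intro x hx y hy hxy
        exact hsinj hx hy (mob_inj hbn (hsn x hx) (hsn y hy) hxy)
      · intro z hz
        exact mem_ball_zero_iff.2 (mob_facts hbn (hsn z hz)).2
      · simp [G, ← hb]
    have hle : ‖deriv G z₀‖ ≤ M := le_csSup hSb ⟨G, hPG, rfl⟩
    -- compute derivatives
    have hb2 : b ^ 2 = -w := by
      rw [hb, hs z₀ hz₀]; simp [g, hf0]
    have hder_s : 2 * b * deriv s z₀ = (1 - (starRingEnd ℂ) w * w) * deriv f z₀ := by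
      have h1 : HasDerivAt (fun z => s z ^ 2) (2 * b * deriv s z₀) z₀ := by
        have := (((hsD z₀ hz₀).differentiableAt (hV.mem_nhds hz₀)).hasDerivAt).fun_pow 2
        simpa [hb] using this
      have h2 := hgd z₀ hz₀
      have h3 : g =ᶠ[𝓝 z₀] fun z => s z ^ 2 := by
        filter_upwards [hV.mem_nhds hz₀] with z hz using (hs z hz).symm
      have h4 := (h1.congr_of_eventuallyEq h3).unique h2
      rw [h4, hf0]; simp
    have hconj : ∀ x : ℂ, (1 - (starRingEnd ℂ) x * x) = ((1 - ‖x‖ ^ 2 : ℝ) : ℂ) := by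
      intro x
      rw [mul_comm, Complex.mul_conj, Complex.normSq_eq_norm_sq]; push_cast; ring
    set β := ‖b‖ with hβ
    have hβpos : 0 < β := by
      rw [hβ, norm_pos_iff]
      intro h
      rw [h] at hb2
      apply hw0
      have : -w = 0 := by rw [← hb2]; simp
      simpa using this
    have hβw : ‖w‖ = β ^ 2 := by rw [hβ, ← norm_pow, hb2, norm_neg]
    have hdG : ‖deriv G z₀‖ * (1 - β ^ 2) = ‖deriv s z₀‖ := by
      rw [(hGd z₀ hz₀).deriv, ← hb, hconj, norm_mul, norm_div, norm_pow]
      have : (0 : ℝ) < 1 - β ^ 2 := by nlinarith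
      rw [Complex.norm_real, Real.norm_of_nonneg this.le]
      field_simp
    have hds : 2 * β * ‖deriv s z₀‖ = (1 - β ^ 4) * M := by
      have := congrArg norm hder_s
      rw [hconj, norm_mul, norm_mul, norm_mul, Complex.norm_real, hfM, hβw] at this
      have h4 : (0 : ℝ) < 1 - (β ^ 2) ^ 2 := by
        have : β ^ 2 < 1 := by nlinarith
        nlinarith [sq_nonneg β]
      rw [Real.norm_of_nonneg h4.le] at this
      simp only [RCLike.norm_ofNat] at this
      rw [← hβ] at this
      rw [this]; ring
    have h1 : (0 : ℝ) < 1 - β ^ 2 := by nlinarith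
    have h5 : 2 * β * ‖deriv G z₀‖ = (1 + β ^ 2) * M := by
      have : (1 - β ^ 2) * (2 * β * ‖deriv G z₀‖) = (1 - β ^ 2) * ((1 + β ^ 2) * M) := by
        linear_combination 2 * β * hdG + hds
      exact mul_left_cancel₀ h1.ne' this
    have h6 : 2 * β * ‖deriv G z₀‖ ≤ 2 * β * M := by gcongr
    have h7 : 0 < (1 - β) ^ 2 * M := by
      have : 0 < 1 - β := by linarith
      positivity
    nlinarith
  let e : ↥V ≃ ↥Disk := Equiv.ofBijective (fun z => ⟨f z.1, hmaps z.2⟩) ⟨by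
      intro a b hab
      exact Subtype.ext (hinj a.2 b.2 (congrArg Subtype.val hab)), by
      rintro ⟨w, hw⟩
      obtain ⟨z, hz, hzw⟩ := hsurj hw
      exact ⟨⟨z, hz⟩, Subtype.ext hzw⟩⟩
  refine ⟨e.toHomeomorphOfContinuousOpen ?_ ?_⟩
  · exact Continuous.subtype_mk (continuousOn_iff_continuous_domRestrict.1 hfd.continuousOn) _
  · intro s hs
    have h1 : IsOpen (f '' (Subtype.val '' s)) :=
      hopen _ (by rintro _ ⟨z, -, rfl⟩; exact z.2) (hV.isOpenMap_subtype_val s hs)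
    have h2 : e '' s = Subtype.val ⁻¹' (f '' (Subtype.val '' s)) := by
      ext y
      constructor
      · rintro ⟨x, hx, rfl⟩
        exact ⟨x.1, ⟨x, hx, rfl⟩, rfl⟩
      · rintro ⟨_, ⟨x, hx, rfl⟩, hxy⟩
        exact ⟨x, hx, Subtype.ext hxy⟩
    rw [h2]
    exact h1.preimage continuous_subtype_val


/-- `g` has a continuous logarithm on `X`. -/
def LogOn (g : ℂ → ℂ) (X : Set ℂ) : Prop :=
  ∃ h : ℂ → ℂ, ContinuousOn h X ∧ ∀ z ∈ X, Complex.exp (h z) = g z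

lemma contOn_glue {X Y : Set ℂ} (hX : IsClosed X) (hY : IsClosed Y) {a b : ℂ → ℂ}
    (ha : ContinuousOn a X) (hb : ContinuousOn b Y) (hab : ∀ z ∈ X, z ∈ Y → a z = b z) :
    ∃ c : ℂ → ℂ, ContinuousOn c (X ∪ Y) ∧ (∀ z ∈ X, c z = a z) ∧ (∀ z ∈ Y, c z = b z) := by
  classical
  refine ⟨fun z => if z ∈ X then a z else b z, ?_, ?_, ?_⟩
  · apply ContinuousOn.union_of_isClosed _ _ hX hY
    · exact ha.congr (fun z hz => by simp [hz])
    · refine hb.congr (fun z hz => ?_)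
      by_cases h : z ∈ X
      · simp [h, hab z h hz]
      · simp [h]
  · intro z hz; simp [hz]
  · intro z hz
    by_cases h : z ∈ X
    · simp [h, hab z h hz]
    · simp [h]

lemma logOn_union {g : ℂ → ℂ} {X Y : Set ℂ} (hX : IsClosed X) (hY : IsClosed Y)
    (h1 : LogOn g X) (h2 : LogOn g Y) (hs : (X ∩ Y).Subsingleton) : LogOn g (X ∪ Y) := by
  obtain ⟨a, ha, hae⟩ := h1
  obtain ⟨b, hb, hbe⟩ := h2
  have : ∃ k : ℂ, Complex.exp k = 1 ∧ ∀ z ∈ X, z ∈ Y → a z = b z + k := by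
    by_cases hne : (X ∩ Y).Nonempty
    · obtain ⟨p, hpX, hpY⟩ := hne
      refine ⟨a p - b p, ?_, ?_⟩
      · rw [Complex.exp_sub, hae p hpX, hbe p hpY, div_self]
        rw [← hae p hpX]; exact Complex.exp_ne_zero _
      · intro z h1 h2
        rw [hs ⟨h1, h2⟩ ⟨hpX, hpY⟩]; ring
    · exact ⟨0, by simp, fun z h1 h2 => absurd ⟨z, h1, h2⟩ hne⟩
  obtain ⟨k, hk, hkk⟩ := this
  obtain ⟨c, hc, hcX, hcY⟩ := contOn_glue hX hY ha
    (hb.add (continuousOn_const (c := k))) hkk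
  refine ⟨c, hc, ?_⟩
  rintro z (hz | hz)
  · rw [hcX z hz, hae z hz]
  · rw [hcY z hz]
    change Complex.exp (b z + k) = _
    rw [Complex.exp_add, hk, mul_one, hbe z hz]

lemma logOn_small {g : ℂ → ℂ} {X : Set ℂ} (hg : ContinuousOn g X) {w : ℂ}
    (hw : ∀ z ∈ X, ‖g z - w‖ < ‖w‖) : LogOn g X := by
  by_cases hne : w = 0
  · refine ⟨0, continuousOn_const, fun z hz => ?_⟩
    have := hw z hz
    simp only [hne, norm_zero] at this
    exact absurd this (not_lt.2 (norm_nonneg _))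
  have hsl : ∀ z ∈ X, g z / w ∈ Complex.slitPlane := by
    intro z hz
    have h1 := hw z hz
    have h2 : ‖g z / w - 1‖ < 1 := by
      rw [div_sub_one hne, norm_div, div_lt_one (norm_pos_iff.2 hne)]; exact h1
    left
    have := (abs_lt.1 ((Complex.abs_re_le_norm _).trans_lt h2)).1
    simp only [Complex.sub_re, Complex.one_re] at this
    linarith
  refine ⟨fun z => Complex.log (g z / w) + Complex.log w,
    ((hg.div_const w).clog hsl).add continuousOn_const, ?_⟩
  intro z hz
  have h0 : g z / w ≠ 0 := Complex.slitPlane_ne_zero (hsl z hz)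
  rw [Complex.exp_add, Complex.exp_log h0, Complex.exp_log hne, div_mul_cancel₀ _ hne]

lemma hasLog_of_inj {A : Set ℂ} (hA : IsCompact A) {φ : ℂ → ℝ} (hφ : ContinuousOn φ A)
    (hinj : InjOn φ A) : HasLog A := by
  intro g hg h0
  have hm : ∃ m > 0, ∀ z ∈ A, m ≤ ‖g z‖ := by
    rcases A.eq_empty_or_nonempty with h | h
    · exact ⟨1, one_pos, by simp [h]⟩
    · obtain ⟨p, hp, hmin⟩ := hA.exists_isMinOn h hg.norm
      exact ⟨‖g p‖, norm_pos_iff.2 (h0 p hp), fun z hz => hmin hz⟩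
  obtain ⟨m, hm0, hm⟩ := hm
  have hδ : ∃ δ > 0, ∀ z ∈ A, ∀ z' ∈ A, |φ z - φ z'| < δ → ‖g z - g z'‖ < m := by
    have hc1 : ContinuousOn (fun q : ℂ × ℂ => ‖g q.1 - g q.2‖) (A ×ˢ A) :=
      ((hg.comp continuousOn_fst (fun q hq => hq.1)).sub
        (hg.comp continuousOn_snd (fun q hq => hq.2))).norm
    have hc2 : ContinuousOn (fun q : ℂ × ℂ => |φ q.1 - φ q.2|) (A ×ˢ A) :=
      ((hφ.comp continuousOn_fst (fun q hq => hq.1)).sub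
        (hφ.comp continuousOn_snd (fun q hq => hq.2))).abs
    have hcl : IsClosed (A ×ˢ A ∩ (fun q : ℂ × ℂ => ‖g q.1 - g q.2‖) ⁻¹' Ici m) :=
      hc1.preimage_isClosed_of_isClosed (hA.prod hA).isClosed isClosed_Ici
    have hcomp := (hA.prod hA).of_isClosed_subset hcl inter_subset_left
    rcases (A ×ˢ A ∩ (fun q : ℂ × ℂ => ‖g q.1 - g q.2‖) ⁻¹' Ici m).eq_empty_or_nonempty with h | h
    · refine ⟨1, one_pos, fun z hz z' hz' _ => ?_⟩
      by_contra hcon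
      have : (z, z') ∈ (∅ : Set (ℂ × ℂ)) := h ▸ ⟨⟨hz, hz'⟩, not_lt.1 hcon⟩
      exact this
    · obtain ⟨p, hp, hmin⟩ := hcomp.exists_isMinOn h (hc2.mono inter_subset_left)
      refine ⟨|φ p.1 - φ p.2|, ?_, fun z hz z' hz' hlt => ?_⟩
      · rw [gt_iff_lt, abs_pos, sub_ne_zero]
        intro he
        have := hinj hp.1.1 hp.1.2 he
        have h3 : m ≤ ‖g p.1 - g p.2‖ := hp.2
        rw [this, sub_self, norm_zero] at h3
        linarith
      · by_contra hcon
        have : |φ p.1 - φ p.2| ≤ |φ z - φ z'| :=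
          hmin (show (z, z') ∈ _ from ⟨⟨hz, hz'⟩, not_lt.1 hcon⟩)
        linarith
  obtain ⟨δ, hδ0, hδ⟩ := hδ
  obtain ⟨R, hR⟩ : ∃ R, ∀ z ∈ A, |φ z| ≤ R := by
    obtain ⟨R, hR⟩ := (hA.image_of_continuousOn hφ).isBounded.exists_norm_le
    exact ⟨R, fun z hz => hR _ ⟨z, hz, rfl⟩⟩
  have hcl : ∀ S : Set ℝ, IsClosed S → IsClosed (A ∩ φ ⁻¹' S) := fun S hS =>
    hφ.preimage_isClosed_of_isClosed hA.isClosed hS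
  have hpiece : ∀ u : ℝ, LogOn g (A ∩ φ ⁻¹' Icc u (u + δ / 2)) := by
    intro u
    rcases (A ∩ φ ⁻¹' Icc u (u + δ / 2)).eq_empty_or_nonempty with h | ⟨p, hp⟩
    · exact ⟨0, continuousOn_const, by simp [h]⟩
    · apply logOn_small (hg.mono inter_subset_left) (w := g p)
      intro z hz
      refine lt_of_lt_of_le (hδ z hz.1 p hp.1 ?_) (hm p hp.1)
      have h1 := hz.2
      have h2 := hp.2
      simp only [mem_preimage, mem_Icc] at h1 h2
      rw [abs_lt]; constructor <;> linarith
  have hind : ∀ k : ℕ, LogOn g (A ∩ φ ⁻¹' Icc (-R) (-R + k * (δ / 2))) := by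
    intro k
    induction k with
    | zero =>
      obtain ⟨h, h1, h2⟩ := hpiece (-R)
      have hsub : A ∩ φ ⁻¹' Icc (-R) (-R + (0 : ℕ) * (δ / 2)) ⊆
          A ∩ φ ⁻¹' Icc (-R) (-R + δ / 2) := by
        rintro z ⟨hz, hz2⟩
        simp only [mem_preimage, mem_Icc] at hz2 ⊢
        refine ⟨hz, hz2.1, ?_⟩
        have := hz2.2
        simp at this
        linarith
      exact ⟨h, h1.mono hsub, fun z hz => h2 z (hsub hz)⟩
    | succ k ih =>
      have := logOn_union (hcl _ isClosed_Icc) (hcl _ isClosed_Icc) ih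
        (hpiece (-R + k * (δ / 2))) (by
          rintro x ⟨⟨hx, hx1⟩, -, hx2⟩ y ⟨⟨hy, hy1⟩, -, hy2⟩
          apply hinj hx hy
          simp only [mem_preimage, mem_Icc] at hx1 hx2 hy1 hy2
          linarith)
      convert this using 1
      ext z
      simp only [mem_inter_iff, mem_union, mem_preimage, mem_Icc]
      push_cast
      have : (0 : ℝ) ≤ k * (δ / 2) := by positivity
      constructor
      · rintro ⟨h1, h2, h3⟩
        rcases le_total (φ z) (-R + k * (δ / 2)) with h | h
        · exact Or.inl ⟨h1, h2, h⟩
        · exact Or.inr ⟨h1, h, by linarith⟩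
      · rintro (⟨h1, h2, h3⟩ | ⟨h1, h2, h3⟩)
        · exact ⟨h1, h2, by linarith⟩
        · exact ⟨h1, by linarith, by linarith⟩
  obtain ⟨k, hk⟩ := exists_nat_ge ((2 * R) / (δ / 2))
  obtain ⟨h, h1, h2⟩ := hind k
  have hsub : A ⊆ A ∩ φ ⁻¹' Icc (-R) (-R + k * (δ / 2)) := by
    intro z hz
    have h3 := abs_le.1 (hR z hz)
    rw [div_le_iff₀ (by positivity)] at hk
    exact ⟨hz, h3.1, by linarith [h3.2]⟩
  exact ⟨h, h1.mono hsub, fun z hz => h2 z (hsub hz)⟩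

lemma hasLog_rect (N : ℝ) (hN : 0 ≤ N) :
    HasLog {z : ℂ | (-N ≤ z.re ∧ z.re ≤ N) ∧ (-N ≤ z.im ∧ z.im ≤ N)} := by
  intro g hg h0
  set S := {z : ℂ | (-N ≤ z.re ∧ z.re ≤ N) ∧ (-N ≤ z.im ∧ z.im ≤ N)} with hS
  set r : ℂ → ℂ := fun z => ((max (-N) (min z.re N) : ℝ) : ℂ) +
    ((max (-N) (min z.im N) : ℝ) : ℂ) * Complex.I with hr
  have hrc : Continuous r := by
    have := Complex.continuous_re
    have := Complex.continuous_im
    fun_prop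
  have hrS : ∀ z, r z ∈ S := by
    intro z
    simp only [hr, hS, mem_ofPred_eq, Complex.add_re, Complex.ofReal_re, Complex.mul_re,
      Complex.I_re, Complex.I_im, Complex.ofReal_im, Complex.add_im, Complex.mul_im, mul_zero,
      mul_one, add_zero, zero_add, sub_zero]
    refine ⟨⟨le_max_left _ _, max_le (by linarith) (min_le_right _ _)⟩,
      ⟨le_max_left _ _, max_le (by linarith) (min_le_right _ _)⟩⟩
  have hrid : ∀ z ∈ S, r z = z := by
    intro z hz
    obtain ⟨⟨h1, h2⟩, h3, h4⟩ := hz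
    simp only [hr]
    rw [min_eq_left h2, min_eq_left h4, max_eq_right h1, max_eq_right h3, Complex.re_add_im]
  have hsc : IsSimplyConnected (univ : Set ℂ) := by
    have := convex_univ.contractibleSpace (univ_nonempty (α := ℂ))
    exact SimplyConnectedSpace.ofContractible _
  obtain ⟨h, hc, he⟩ := Complex.exists_continuousOn_eqOn_exp_comp hsc isOpen_univ
    (g := g ∘ r) (hg.comp hrc.continuousOn (fun z _ => hrS z)) (by
      rintro ⟨z, -, hz⟩; exact h0 _ (hrS z) hz)
  refine ⟨h, hc.mono (subset_univ _), fun z hz => ?_⟩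
  have := he (mem_univ z)
  simp only [Function.comp] at this
  rw [this, hrid z hz]

/-- sup norm on the plane -/
def supn (z : ℂ) : ℝ := max |z.re| |z.im|

lemma supn_mul (r : ℝ) (hr : 0 ≤ r) (z : ℂ) : supn ((r : ℂ) * z) = r * supn z := by
  simp [supn, abs_mul, abs_of_nonneg hr, mul_max_of_nonneg _ _ hr]

lemma supn_inj {z w : ℂ} {s : ℝ} (hs : 0 < s) (hz : supn z = s) (hw : supn w = s)
    {r : ℝ} (hr : 0 ≤ r) (h : (r : ℂ) * z = w) : z = w := by
  have := supn_mul r hr z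
  rw [h, hz, hw] at this
  have : r = 1 := by
    have h2 : (r - 1) * s = 0 := by linarith
    rcases mul_eq_zero.1 h2 with h3 | h3
    · linarith
    · linarith
  rw [← h, this]; simp

lemma supn_ne {z : ℂ} {s : ℝ} (hs : 0 < s) (hz : supn z = s) : z ≠ 0 := by
  rintro rfl
  simp [supn] at hz
  linarith

lemma hasLog_square_bd {A : Set ℂ} (hA : IsCompact A) {c0 p : ℂ} {s : ℝ} (hs : 0 < s)
    (hp : supn (p - c0) = s) (hAs : ∀ z ∈ A, supn (z - c0) = s) (hpA : p ∉ A) : HasLog A := by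
  have hq := supn_ne hs hp
  have key : ∀ z w : ℂ, supn (z - c0) = s → supn (w - c0) = s →
      Complex.arg (-(z - c0) / (p - c0)) = Complex.arg (-(w - c0) / (p - c0)) → z = w := by
    intro z w hz hw h
    have hz0 := supn_ne hs hz
    have hw0 := supn_ne hs hw
    rw [Complex.arg_eq_arg_iff (div_ne_zero (neg_ne_zero.2 hz0) hq)
      (div_ne_zero (neg_ne_zero.2 hw0) hq)] at h
    rw [← mul_div_assoc, div_left_inj' hq, mul_neg, neg_inj] at h
    have := supn_inj hs hz hw (r := ‖-(w - c0) / (p - c0)‖ / ‖-(z - c0) / (p - c0)‖)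
      (by positivity) (by push_cast; exact h)
    exact sub_left_injective this
  apply hasLog_of_inj hA (φ := fun z => Complex.arg (-(z - c0) / (p - c0)))
  · intro z hz
    have hsl : -(z - c0) / (p - c0) ∈ Complex.slitPlane := by
      rw [Complex.mem_slitPlane_iff_arg]
      refine ⟨?_, div_ne_zero (neg_ne_zero.2 (supn_ne hs (hAs z hz))) hq⟩
      intro h
      have h1 : Complex.arg (-(p - c0) / (p - c0)) = Real.pi := by
        rw [neg_div, div_self hq, Complex.arg_neg_one]
      rw [key z p (hAs z hz) hp (h.trans h1.symm)] at hz
      exact hpA hz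
    have h2 : ContinuousAt (fun z => -(z - c0) / (p - c0)) z := by fun_prop
    exact ((Complex.continuousAt_arg hsl).comp (f := fun z => -(z - c0) / (p - c0)) h2).continuousWithinAt
  · intro z hz w hw h
    exact key z w (hAs z hz) (hAs w hw) h

/-- unit grid cell -/
def cell (c : ℤ × ℤ) : Set ℂ :=
  {z | ((c.1 : ℝ) ≤ z.re ∧ z.re ≤ c.1 + 1) ∧ ((c.2 : ℝ) ≤ z.im ∧ z.im ≤ c.2 + 1)}

lemma isClosed_cell (c : ℤ × ℤ) : IsClosed (cell c) := by
  have h1 := Complex.continuous_re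
  have h2 := Complex.continuous_im
  exact ((isClosed_le continuous_const h1).inter (isClosed_le h1 continuous_const)).inter
    ((isClosed_le continuous_const h2).inter (isClosed_le h2 continuous_const))

lemma cell_bounded (c : ℤ × ℤ) : Bornology.IsBounded (cell c) := by
  rw [isBounded_iff_forall_norm_le]
  refine ⟨(|(c.1 : ℝ)| + 1) + (|(c.2 : ℝ)| + 1), ?_⟩
  rintro z ⟨⟨h1, h2⟩, h3, h4⟩
  refine (Complex.norm_le_abs_re_add_abs_im z).trans (add_le_add ?_ ?_)
  · rw [abs_le]; constructor
    · linarith [neg_abs_le (c.1 : ℝ)]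
    · linarith [le_abs_self (c.1 : ℝ)]
  · rw [abs_le]; constructor
    · linarith [neg_abs_le (c.2 : ℝ)]
    · linarith [le_abs_self (c.2 : ℝ)]

/-- union of cells -/
def cells (T : Finset (ℤ × ℤ)) : Set ℂ := ⋃ c ∈ T, cell c

lemma mem_cells {T : Finset (ℤ × ℤ)} {z : ℂ} : z ∈ cells T ↔ ∃ c ∈ T, z ∈ cell c := by
  simp [cells]

lemma isClosed_cells (T : Finset (ℤ × ℤ)) : IsClosed (cells T) :=
  isClosed_biUnion_finset (fun c _ => isClosed_cell c)

lemma cells_bounded (T : Finset (ℤ × ℤ)) : Bornology.IsBounded (cells T) :=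
  (Bornology.isBounded_biUnion_finset T).2 (fun c _ => cell_bounded c)

/-- 4-neighbours -/
def Nb (c d : ℤ × ℤ) : Prop :=
  (d.1 = c.1 + 1 ∧ d.2 = c.2) ∨ (d.1 = c.1 - 1 ∧ d.2 = c.2) ∨
  (d.1 = c.1 ∧ d.2 = c.2 + 1) ∨ (d.1 = c.1 ∧ d.2 = c.2 - 1)

lemma cell_geom {c c' : ℤ × ℤ} (h : Nb c c') :
    ∃ c0 p : ℂ, supn (p - c0) = 1 / 2 ∧ (∀ d, d ≠ c → ∀ z ∈ cell c, z ∈ cell d →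
      supn (z - c0) = 1 / 2) ∧ (∀ d, d ≠ c → p ∈ cell d → d = c') := by
  obtain ⟨a, b⟩ := c
  obtain ⟨a', b'⟩ := c'
  refine ⟨⟨a + 1 / 2, b + 1 / 2⟩,
    ⟨a + 1 / 2 + (a' - a) / 2, b + 1 / 2 + (b' - b) / 2⟩, ?_, ?_, ?_⟩
  · simp only [Nb] at h
    simp only [supn, Complex.sub_re, Complex.sub_im]
    rcases h with ⟨h1, h2⟩ | ⟨h1, h2⟩ | ⟨h1, h2⟩ | ⟨h1, h2⟩ <;> subst h1 <;> subst h2 <;>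
      push_cast <;> ring_nf <;> norm_num [abs_of_pos, abs_of_neg]
  · rintro ⟨x, y⟩ hd z ⟨⟨h1, h2⟩, h3, h4⟩ ⟨⟨h5, h6⟩, h7, h8⟩
    simp only [supn, Complex.sub_re, Complex.sub_im]
    simp only at h1 h2 h3 h4 h5 h6 h7 h8
    have hA : |z.re - (a + 1 / 2)| ≤ 1 / 2 := by rw [abs_le]; constructor <;> linarith
    have hB : |z.im - (b + 1 / 2)| ≤ 1 / 2 := by rw [abs_le]; constructor <;> linarith
    have : x ≠ a ∨ y ≠ b := by
      by_contra hcon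
      push Not at hcon
      exact hd (by rw [hcon.1, hcon.2])
    apply le_antisymm (max_le hA hB)
    rcases this with h | h
    · refine le_trans ?_ (le_max_left _ _)
      rcases lt_or_gt_of_ne h with h | h
      · have : (x : ℝ) + 1 ≤ a := by exact_mod_cast h
        refine le_trans ?_ (neg_le_abs _); linarith
      · have : (a : ℝ) + 1 ≤ x := by exact_mod_cast h
        refine le_trans ?_ (le_abs_self _); linarith
    · refine le_trans ?_ (le_max_right _ _)
      rcases lt_or_gt_of_ne h with h | h
      · have : (y : ℝ) + 1 ≤ b := by exact_mod_cast h
        refine le_trans ?_ (neg_le_abs _); linarith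
      · have : (b : ℝ) + 1 ≤ y := by exact_mod_cast h
        refine le_trans ?_ (le_abs_self _); linarith
  · rintro ⟨x, y⟩ hd ⟨⟨h5, h6⟩, h7, h8⟩
    simp only at h5 h6 h7 h8
    have e1 : 2 * x ≤ a + 1 + a' := by
      have : (2 * x : ℝ) ≤ a + 1 + a' := by linarith
      exact_mod_cast this
    have e2 : a + 1 + a' ≤ 2 * x + 2 := by
      have : (a + 1 + a' : ℝ) ≤ 2 * x + 2 := by linarith
      exact_mod_cast this
    have e3 : 2 * y ≤ b + 1 + b' := by
      have : (2 * y : ℝ) ≤ b + 1 + b' := by linarith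
      exact_mod_cast this
    have e4 : b + 1 + b' ≤ 2 * y + 2 := by
      have : (b + 1 + b' : ℝ) ≤ 2 * y + 2 := by linarith
      exact_mod_cast this
    simp only [Nb] at h
    simp only [ne_eq, Prod.mk.injEq, not_and] at hd ⊢
    omega

lemma dig {T : Finset (ℤ × ℤ)} (hT : HasLog (cells T)) {c c' : ℤ × ℤ} (_hc : c ∈ T)
    (hc' : c' ∉ T) (hn : Nb c c') : HasLog (cells (T.erase c)) := by
  intro g hg h0
  obtain ⟨c0, p, hp, hbd, hpd⟩ := cell_geom hn
  have hA : IsCompact (cell c ∩ cells (T.erase c)) :=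
    Metric.isCompact_of_isClosed_isBounded ((isClosed_cell c).inter (isClosed_cells _))
      ((cell_bounded c).subset inter_subset_left)
  have hAL : HasLog (cell c ∩ cells (T.erase c)) := by
    apply hasLog_square_bd hA (c0 := c0) (p := p) (s := 1 / 2) (by norm_num) hp
    · rintro z ⟨hz, hz2⟩
      obtain ⟨d, hd, hzd⟩ := mem_cells.1 hz2
      exact hbd d (Finset.ne_of_mem_erase hd) z hz hzd
    · rintro ⟨-, hz2⟩
      obtain ⟨d, hd, hzd⟩ := mem_cells.1 hz2
      have := hpd d (Finset.ne_of_mem_erase hd) hzd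
      exact hc' (this ▸ Finset.mem_of_mem_erase hd)
  obtain ⟨h, hh, hhe⟩ := hAL g (hg.mono inter_subset_right) (fun z hz => h0 z hz.2)
  obtain ⟨H, hH⟩ := ContinuousMap.exists_restrict_eq hA.isClosed
    (⟨_, continuousOn_iff_continuous_domRestrict.1 hh⟩ : C(_, ℂ))
  have hHh : ∀ z ∈ cell c ∩ cells (T.erase c), H z = h z := fun z hz =>
    congrArg (fun F => F ⟨z, hz⟩) hH
  obtain ⟨G, hG, hG1, hG2⟩ := contOn_glue (isClosed_cells (T.erase c)) (isClosed_cell c) hg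
    (b := fun z => Complex.exp (H z)) (by fun_prop) (fun z hz hz' => by
      rw [hHh z ⟨hz', hz⟩, hhe z ⟨hz', hz⟩])
  have hsub : cells T ⊆ cells (T.erase c) ∪ cell c := by
    intro z hz
    obtain ⟨d, hd, hzd⟩ := mem_cells.1 hz
    by_cases hdc : d = c
    · right; exact hdc ▸ hzd
    · left; exact mem_cells.2 ⟨d, Finset.mem_erase.2 ⟨hdc, hd⟩, hzd⟩
  obtain ⟨k, hk, hke⟩ := hT G (hG.mono hsub) (by
    intro z hz
    rcases hsub hz with h | h
    · rw [hG1 z h]; exact h0 z h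
    · rw [hG2 z h]; exact Complex.exp_ne_zero _)
  have hsub2 : cells (T.erase c) ⊆ cells T := by
    intro z hz
    obtain ⟨d, hd, hzd⟩ := mem_cells.1 hz
    exact mem_cells.2 ⟨d, Finset.mem_of_mem_erase hd, hzd⟩
  exact ⟨k, hk.mono hsub2, fun z hz => by rw [hke z (hsub2 hz), hG1 z hz]⟩

/-- no bounded complementary parts -/
def Full (V : Set ℂ) : Prop :=
  ∀ B : Set ℂ, IsOpen B → Bornology.IsBounded B → frontier B ⊆ V → B ⊆ V

lemma mem_cell_floor (z : ℂ) : z ∈ cell (⌊z.re⌋, ⌊z.im⌋) :=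
  ⟨⟨Int.floor_le _, (Int.lt_floor_add_one _).le⟩, ⟨Int.floor_le _, (Int.lt_floor_add_one _).le⟩⟩

lemma cell_subset_closure (c : ℤ × ℤ) : cell c ⊆ closure (interior (cell c)) := by
  have h : cell c = Icc (c.1 : ℝ) (c.1 + 1) ×ℂ Icc (c.2 : ℝ) (c.2 + 1) := by
    ext z; simp [cell, Complex.mem_reProdIm]
  rw [h, Complex.interior_reProdIm, Complex.closure_reProdIm, interior_Icc, interior_Icc,
    closure_Ioo (by linarith), closure_Ioo (by linarith)]

lemma cell_subset_ball {c : ℤ × ℤ} {z : ℂ} (hz : z ∈ cell c) : cell c ⊆ closedBall z 2 := by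
  rintro w ⟨⟨h1, h2⟩, h3, h4⟩
  obtain ⟨⟨h5, h6⟩, h7, h8⟩ := hz
  rw [mem_closedBall, dist_eq_norm]
  refine (Complex.norm_le_abs_re_add_abs_im _).trans ?_
  have hA : |(w - z).re| ≤ 1 := by rw [Complex.sub_re, abs_le]; constructor <;> linarith
  have hB : |(w - z).im| ≤ 1 := by rw [Complex.sub_im, abs_le]; constructor <;> linarith
  linarith

lemma mem_interior_cells {H : Finset (ℤ × ℤ)} {z : ℂ} (h : ∀ d, z ∈ cell d → d ∈ H) :
    z ∈ interior (cells H) := by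
  classical
  set F : Finset (ℤ × ℤ) := (Finset.Icc (⌊z.re⌋ - 2) (⌊z.re⌋ + 2)) ×ˢ
    (Finset.Icc (⌊z.im⌋ - 2) (⌊z.im⌋ + 2)) with hF
  set S := F.filter (fun d => z ∉ cell d) with hS
  rw [mem_interior]
  refine ⟨(cells S)ᶜ ∩ ball z 1, ?_, (isClosed_cells S).isOpen_compl.inter isOpen_ball, ?_,
    mem_ball_self one_pos⟩
  · rintro w ⟨hw1, hw2⟩
    have hd := mem_cell_floor w
    refine mem_cells.2 ⟨_, h _ ?_, hd⟩
    by_contra hcon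
    apply hw1
    refine mem_cells.2 ⟨_, ?_, hd⟩
    rw [hS, Finset.mem_filter]
    refine ⟨?_, hcon⟩
    rw [mem_ball, dist_eq_norm] at hw2
    have a1 := abs_le.1 ((Complex.abs_re_le_norm (w - z)).trans hw2.le)
    have a2 := abs_le.1 ((Complex.abs_im_le_norm (w - z)).trans hw2.le)
    simp only [Complex.sub_re, Complex.sub_im] at a1 a2
    simp only [hF, Finset.mem_product, Finset.mem_Icc]
    refine ⟨⟨?_, ?_⟩, ?_, ?_⟩
    · rw [Int.le_floor]; push_cast; linarith [Int.floor_le z.re]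
    · rw [← Int.lt_add_one_iff, Int.floor_lt]; push_cast; linarith [Int.lt_floor_add_one z.re]
    · rw [Int.le_floor]; push_cast; linarith [Int.floor_le z.im]
    · rw [← Int.lt_add_one_iff, Int.floor_lt]; push_cast; linarith [Int.lt_floor_add_one z.im]
  · intro hz
    obtain ⟨d, hd, hzd⟩ := mem_cells.1 hz
    exact (Finset.mem_filter.1 hd).2 hzd

lemma full_log_unit {V J : Set ℂ} (hfull : Full V) (hJ : IsCompact J)
    (hJV : ∀ z ∈ J, closedBall z 2 ⊆ V) {g : ℂ → ℂ} (hg : ContinuousOn g V)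
    (h0 : ∀ z ∈ V, g z ≠ 0) : LogOn g J := by
  classical
  obtain ⟨R, hR⟩ := hJ.isBounded.exists_norm_le
  obtain ⟨N, hN⟩ := exists_nat_ge R
  set Box : Finset (ℤ × ℤ) := (Finset.Icc (-(N : ℤ)) N) ×ˢ (Finset.Icc (-(N : ℤ)) N) with hBox
  have hBoxL : HasLog (cells Box) := by
    have : cells Box = {z : ℂ | (-((N : ℝ) + 1 / 2) ≤ (z - (1 / 2 + Complex.I / 2)).re ∧ (z - (1 / 2 + Complex.I / 2)).re ≤ (N : ℝ) + 1 / 2) ∧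
        (-((N : ℝ) + 1 / 2) ≤ (z - (1 / 2 + Complex.I / 2)).im ∧ (z - (1 / 2 + Complex.I / 2)).im ≤ (N : ℝ) + 1 / 2)} := by
      ext z
      have e1 : (z - (1 / 2 + Complex.I / 2)).re = z.re - 1 / 2 := by simp
      have e2 : (z - (1 / 2 + Complex.I / 2)).im = z.im - 1 / 2 := by simp
      rw [mem_ofPred_eq, e1, e2, mem_cells]
      constructor
      · rintro ⟨c, hc, ⟨h1, h2⟩, h3, h4⟩
        simp only [hBox, Finset.mem_product, Finset.mem_Icc] at hc
        obtain ⟨⟨b1, b2⟩, b3, b4⟩ := hc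
        have b1 : (-(N : ℝ)) ≤ c.1 := by exact_mod_cast b1
        have b2 : (c.1 : ℝ) ≤ N := by exact_mod_cast b2
        have b3 : (-(N : ℝ)) ≤ c.2 := by exact_mod_cast b3
        have b4 : (c.2 : ℝ) ≤ N := by exact_mod_cast b4
        refine ⟨⟨?_, ?_⟩, ?_, ?_⟩ <;> linarith
      · rintro ⟨⟨h1, h2⟩, h3, h4⟩
        have hex : ∀ x : ℝ, -((N : ℝ) + 1 / 2) ≤ x - 1 / 2 → x - 1 / 2 ≤ (N : ℝ) + 1 / 2 →
            ∃ k : ℤ, -(N : ℤ) ≤ k ∧ k ≤ N ∧ (k : ℝ) ≤ x ∧ x ≤ k + 1 := by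
          intro x hx1 hx2
          by_cases hx : x < N + 1
          · refine ⟨⌊x⌋, ?_, ?_, Int.floor_le x, (Int.lt_floor_add_one x).le⟩
            · rw [Int.le_floor]; push_cast; linarith
            · rw [← Int.lt_add_one_iff, Int.floor_lt]; push_cast; linarith
          · refine ⟨N, by omega, le_rfl, ?_, ?_⟩
            · push_cast; linarith
            · push_cast; linarith
        obtain ⟨k, k1, k2, k3, k4⟩ := hex _ h1 h2
        obtain ⟨m, m1, m2, m3, m4⟩ := hex _ h3 h4
        refine ⟨(k, m), ?_, ⟨k3, k4⟩, m3, m4⟩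
        simp only [hBox, Finset.mem_product, Finset.mem_Icc]
        exact ⟨⟨k1, k2⟩, m1, m2⟩
    rw [this]
    intro g hg h0
    have hh := hasLog_rect ((N : ℝ) + 1 / 2) (by positivity) (fun z => g (z + (1 / 2 + Complex.I / 2)))
      (hg.comp (by fun_prop) (by
        intro z hz
        simpa only [mem_ofPred_eq, add_sub_cancel_right] using hz)) (by
        intro z hz
        apply h0
        simpa only [mem_ofPred_eq, add_sub_cancel_right] using hz)
    obtain ⟨h, hc, he⟩ := hh
    refine ⟨fun z => h (z - (1 / 2 + Complex.I / 2)), hc.comp (by fun_prop) (fun z hz => hz), ?_⟩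
    intro z hz
    have := he _ hz
    simp only [sub_add_cancel] at this
    exact this
  set good := Box.filter (fun c => cell c ⊆ V) with hgood
  have hJgood : J ⊆ cells good := by
    intro z hz
    have hzn := (hR z hz).trans hN
    have a1 := abs_le.1 ((Complex.abs_re_le_norm z).trans hzn)
    have a2 := abs_le.1 ((Complex.abs_im_le_norm z).trans hzn)
    refine mem_cells.2 ⟨(⌊z.re⌋, ⌊z.im⌋), ?_, mem_cell_floor z⟩
    rw [hgood, Finset.mem_filter]
    refine ⟨?_, (cell_subset_ball (mem_cell_floor z)).trans (hJV z hz)⟩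
    simp only [hBox, Finset.mem_product, Finset.mem_Icc]
    refine ⟨⟨?_, ?_⟩, ?_, ?_⟩
    · rw [Int.le_floor]; push_cast; linarith
    · rw [← Int.lt_add_one_iff, Int.floor_lt]; push_cast; linarith
    · rw [Int.le_floor]; push_cast; linarith
    · rw [← Int.lt_add_one_iff, Int.floor_lt]; push_cast; linarith
  obtain ⟨T, hT, hmin⟩ := Finset.exists_min_image
    (Box.powerset.filter (fun T => good ⊆ T ∧ HasLog (cells T))) Finset.card
    ⟨Box, by
      rw [Finset.mem_filter]
      exact ⟨Finset.mem_powerset_self _, Finset.filter_subset _ _, hBoxL⟩⟩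
  rw [Finset.mem_filter, Finset.mem_powerset] at hT
  obtain ⟨hTB, hgT, hTL⟩ := hT
  have hnb : ∀ c ∈ T, c ∉ good → ∀ c', Nb c c' → c' ∈ T := by
    intro c hc hcg c' hn
    by_contra hcon
    have h1 := hmin (T.erase c) (by
      rw [Finset.mem_filter, Finset.mem_powerset]
      refine ⟨(Finset.erase_subset _ _).trans hTB, ?_, dig hTL hc hcon hn⟩
      intro d hd
      refine Finset.mem_erase.2 ⟨?_, hgT hd⟩
      rintro rfl; exact hcg hd)
    have h2 := Finset.card_erase_lt_of_mem hc
    omega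
  have hbadV : ∀ c ∈ T, c ∉ good → ¬ cell c ⊆ V := by
    intro c hc hcg hcV
    exact hcg (Finset.mem_filter.2 ⟨hTB hc, hcV⟩)
  have hgoodV : ∀ c ∈ good, cell c ⊆ V := fun c hc => (Finset.mem_filter.1 hc).2
  set H := T \ good with hH
  have hfr : frontier (interior (cells H)) ⊆ V := by
    intro z hz
    have hz := frontier_interior_subset hz
    by_contra hzV
    have hng : ∀ d, z ∈ cell d → d ∉ good := fun d hd hdg => hzV (hgoodV d hdg hd)
    rw [(isClosed_cells H).frontier_eq] at hz
    obtain ⟨c, hc, hzc⟩ := mem_cells.1 hz.1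
    apply hz.2
    apply mem_interior_cells
    intro d hd
    rw [hH, Finset.mem_sdiff] at hc ⊢
    refine ⟨?_, hng d hd⟩
    have hcd : (d.1 = c.1 ∨ d.1 = c.1 + 1 ∨ d.1 = c.1 - 1) ∧
        (d.2 = c.2 ∨ d.2 = c.2 + 1 ∨ d.2 = c.2 - 1) := by
      obtain ⟨⟨h1, h2⟩, h3, h4⟩ := hzc
      obtain ⟨⟨h5, h6⟩, h7, h8⟩ := hd
      have i1 : d.1 ≤ c.1 + 1 := by
        have : (d.1 : ℝ) ≤ c.1 + 1 := by linarith
        exact_mod_cast this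
      have i2 : c.1 ≤ d.1 + 1 := by
        have : (c.1 : ℝ) ≤ d.1 + 1 := by linarith
        exact_mod_cast this
      have i3 : d.2 ≤ c.2 + 1 := by
        have : (d.2 : ℝ) ≤ c.2 + 1 := by linarith
        exact_mod_cast this
      have i4 : c.2 ≤ d.2 + 1 := by
        have : (c.2 : ℝ) ≤ d.2 + 1 := by linarith
        exact_mod_cast this
      omega
    have hze : z ∈ cell (d.1, c.2) := ⟨hd.1, hzc.2⟩
    have heT : ((d.1, c.2) : ℤ × ℤ) ∈ T := by
      by_cases h : d.1 = c.1
      · have : ((d.1, c.2) : ℤ × ℤ) = c := by rw [h]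
        rw [this]; exact hc.1
      · apply hnb c hc.1 hc.2
        rcases hcd.1 with h' | h' | h'
        · exact absurd h' h
        · exact Or.inl ⟨h', rfl⟩
        · exact Or.inr (Or.inl ⟨h', rfl⟩)
    by_cases h : d.2 = c.2
    · have : ((d.1, c.2) : ℤ × ℤ) = d := by rw [← h]
      rw [← this]; exact heT
    · apply hnb _ heT (hng _ hze)
      rcases hcd.2 with h' | h' | h'
      · exact absurd h' h
      · exact Or.inr (Or.inr (Or.inl ⟨rfl, h'⟩))
      · exact Or.inr (Or.inr (Or.inr ⟨rfl, h'⟩))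
  have hsub := hfull _ isOpen_interior ((cells_bounded H).subset interior_subset) hfr
  have hHe : T ⊆ good := by
    intro c hc
    by_contra hcg
    apply hbadV c hc hcg
    have h1 : cell c ⊆ cells H := fun z hz => mem_cells.2 ⟨c, Finset.mem_sdiff.2 ⟨hc, hcg⟩, hz⟩
    refine (cell_subset_closure c).trans ((closure_mono (interior_mono h1)).trans ?_)
    rw [closure_eq_self_union_frontier]
    exact union_subset hsub hfr
  have hTV : cells T ⊆ V := by
    intro z hz
    obtain ⟨c, hc, hzc⟩ := mem_cells.1 hz
    exact hgoodV c (hHe hc) hzc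
  obtain ⟨h, hc, he⟩ := hTL g (hg.mono hTV) (fun z hz => h0 z (hTV hz))
  have hJT : J ⊆ cells T := by
    intro z hz
    obtain ⟨c, hc, hzc⟩ := mem_cells.1 (hJgood hz)
    exact mem_cells.2 ⟨c, hgT hc, hzc⟩
  exact ⟨h, hc.mono hJT, fun z hz => he z (hJT hz)⟩

lemma full_log {V J : Set ℂ} (hV : IsOpen V) (hfull : Full V) (hJ : IsCompact J)
    (hJV : J ⊆ V) {g : ℂ → ℂ} (hg : ContinuousOn g V)
    (h0 : ∀ z ∈ V, g z ≠ 0) : LogOn g J := by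
  obtain ⟨δ, hδ, hδV⟩ := hJ.exists_cthickening_subset_open hV hJV
  have hl : ((δ / 2 : ℝ) : ℂ) ≠ 0 := by
    exact_mod_cast (by positivity : δ / 2 ≠ 0)
  set e := Homeomorph.mulLeft₀ ((δ / 2 : ℝ) : ℂ) hl with he
  have hen : ∀ z w, dist (e z) (e w) = δ / 2 * dist z w := by
    intro z w
    simp only [he, Homeomorph.coe_mulLeft₀, dist_eq_norm, ← mul_sub, norm_mul, Complex.norm_real]
    rw [Real.norm_of_nonneg (by positivity)]
  have := full_log_unit (V := e ⁻¹' V) (J := e ⁻¹' J) (g := g ∘ e) ?_ ?_ ?_ ?_ ?_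
  · obtain ⟨h, hc, hh⟩ := this
    refine ⟨h ∘ e.symm, hc.comp e.symm.continuous.continuousOn ?_, ?_⟩
    · intro z hz; simpa using hz
    · intro z hz
      have := hh (e.symm z) (by simpa using hz)
      simpa using this
  · intro B hB hBb hfr
    have h1 : e '' B ⊆ V := by
      apply hfull _ (e.isOpenMap _ hB)
      · rw [isBounded_iff_forall_norm_le] at hBb ⊢
        obtain ⟨C, hC⟩ := hBb
        refine ⟨δ / 2 * C, ?_⟩
        rintro _ ⟨z, hz, rfl⟩
        have h2 := hen z 0
        have h3 : e 0 = 0 := by simp [he]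
        rw [h3, dist_zero_right, dist_zero_right] at h2
        rw [h2]
        exact mul_le_mul_of_nonneg_left (hC z hz) (by positivity)
      · rw [← e.image_frontier]
        exact image_subset_iff.2 hfr
    exact image_subset_iff.1 h1
  · exact e.isCompact_preimage.2 hJ
  · intro z hz w hw
    apply hδV
    apply mem_cthickening_of_dist_le (e w) (e z) δ J hz
    rw [hen]
    rw [mem_closedBall] at hw
    nlinarith
  · exact hg.comp e.continuous.continuousOn (fun z hz => hz)
  · intro z hz; exact h0 _ hz

lemma log_unique {J : Set ℂ} (hJ : IsPreconnected J) {a b : ℂ → ℂ} (ha : ContinuousOn a J)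
    (hb : ContinuousOn b J) (hab : ∀ z ∈ J, Complex.exp (a z) = Complex.exp (b z))
    {z₀ : ℂ} (h0 : z₀ ∈ J) (he : a z₀ = b z₀) {z : ℂ} (hz : z ∈ J) : a z = b z := by
  have hcount : (range (fun n : ℤ => (n : ℂ) * (2 * Real.pi * Complex.I))).Countable :=
    countable_range _
  have hs := hcount.isTotallyDisconnected ((fun z => a z - b z) '' J) (by
    rintro _ ⟨w, hw, rfl⟩
    have : Complex.exp (a w - b w) = 1 := by
      rw [Complex.exp_sub, hab w hw, div_self (Complex.exp_ne_zero _)]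
    obtain ⟨n, hn⟩ := Complex.exp_eq_one_iff.1 this
    exact ⟨n, hn.symm⟩) (hJ.image _ (ha.sub hb))
  have := hs ⟨z, hz, rfl⟩ ⟨z₀, h0, rfl⟩
  simp only [he, sub_self] at this
  exact sub_eq_zero.1 this

lemma hasLog_of_full {V : Set ℂ} (hV : IsOpen V) (hc : IsPreconnected V) (hfull : Full V) :
    HasLog V := by
  intro g hg h0
  rcases V.eq_empty_or_nonempty with h | ⟨z₀, hz₀⟩
  · exact ⟨0, continuousOn_const, by simp [h]⟩
  have hnorm : ∀ J : Set ℂ, IsCompact J → J ⊆ V → z₀ ∈ J → ∃ h : ℂ → ℂ, ContinuousOn h J ∧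
      (∀ z ∈ J, Complex.exp (h z) = g z) ∧ h z₀ = Complex.log (g z₀) := by
    intro J hJ hJV hzJ
    obtain ⟨h, h1, h2⟩ := full_log hV hfull hJ hJV hg h0
    refine ⟨fun z => h z + (Complex.log (g z₀) - h z₀), h1.add continuousOn_const, ?_, by ring⟩
    intro z hz
    rw [Complex.exp_add, Complex.exp_sub, Complex.exp_log (h0 z₀ hz₀), h2 z₀ hzJ, h2 z hz,
      div_self (h0 z₀ hz₀), mul_one]
  have hpc : IsPathConnected V := hV.isConnected_iff_isPathConnected.1 ⟨⟨z₀, hz₀⟩, hc⟩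
  have hJz : ∀ z, ∃ J : Set ℂ, z ∈ V → IsCompact J ∧ J ⊆ V ∧ z₀ ∈ J ∧ z ∈ J ∧ IsPreconnected J := by
    intro z
    by_cases hz : z ∈ V
    · obtain ⟨γ, hγ⟩ := hpc.joinedIn z₀ hz₀ z hz
      refine ⟨range γ, fun _ => ⟨isCompact_range γ.continuous, range_subset_iff.2 hγ,
        ⟨0, γ.source⟩, ⟨1, γ.target⟩, isPreconnected_range γ.continuous⟩⟩
    · exact ⟨∅, fun h => absurd h hz⟩
  choose J hJ using hJz
  have hh : ∀ z, ∃ h : ℂ → ℂ, z ∈ V → ContinuousOn h (J z) ∧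
      (∀ w ∈ J z, Complex.exp (h w) = g w) ∧ h z₀ = Complex.log (g z₀) := by
    intro z
    by_cases hz : z ∈ V
    · obtain ⟨h, hh⟩ := hnorm (J z) (hJ z hz).1 (hJ z hz).2.1 (hJ z hz).2.2.1
      exact ⟨h, fun _ => hh⟩
    · exact ⟨0, fun h => absurd h hz⟩
  choose h hh using hh
  have key : ∀ A : Set ℂ, IsCompact A → A ⊆ V → z₀ ∈ A → IsPreconnected A → ∀ k : ℂ → ℂ,
      ContinuousOn k A → (∀ z ∈ A, Complex.exp (k z) = g z) → k z₀ = Complex.log (g z₀) →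
      ∀ z ∈ A, h z z = k z := by
    intro A hA hAV hzA hAc k hk hke hk0 z hz
    have hzV := hAV hz
    obtain ⟨j1, j2, j3, j4, j5⟩ := hJ z hzV
    obtain ⟨i1, i2, i3⟩ := hh z hzV
    obtain ⟨m, m1, m2, m3⟩ := hnorm (A ∪ J z) (hA.union j1) (union_subset hAV j2) (Or.inl hzA)
    have e1 : m z = k z := log_unique hAc (m1.mono subset_union_left) hk
      (fun w hw => by rw [m2 w (Or.inl hw), hke w hw]) hzA (m3.trans hk0.symm) hz
    have e2 : m z = h z z := log_unique j5 (m1.mono subset_union_right) i1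
      (fun w hw => by rw [m2 w (Or.inr hw), i2 w hw]) j3 (m3.trans i3.symm) j4
    rw [← e1, e2]
  refine ⟨fun z => h z z, ?_, ?_⟩
  · intro z hz
    apply ContinuousAt.continuousWithinAt
    obtain ⟨j1, j2, j3, j4, j5⟩ := hJ z hz
    obtain ⟨ε, hε, hεV⟩ := Metric.nhds_basis_closedBall.mem_iff.1 (hV.mem_nhds hz)
    have hA : IsCompact (J z ∪ closedBall z ε) := j1.union (isCompact_closedBall _ _)
    have hAV : J z ∪ closedBall z ε ⊆ V := union_subset j2 hεV
    have hAc : IsPreconnected (J z ∪ closedBall z ε) :=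
      j5.union z j4 (mem_closedBall_self hε.le) (convex_closedBall z ε).isPreconnected
    obtain ⟨k, k1, k2, k3⟩ := hnorm _ hA hAV (Or.inl j3)
    have hn : J z ∪ closedBall z ε ∈ 𝓝 z :=
      mem_of_superset (closedBall_mem_nhds z hε) subset_union_right
    have := k1.continuousAt hn
    apply this.congr
    filter_upwards [hn] with w hw
    exact (key _ hA hAV (Or.inl j3) hAc k k1 k2 k3 w hw).symm
  · intro z hz
    exact (hh z hz).2.1 z (hJ z hz).2.2.2.1

lemma subset_of_no_frontier {X : Type*} [TopologicalSpace X] {C V : Set X}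
    (hC : IsPreconnected C) (hV : IsOpen V) (hd : C ∩ frontier V = ∅) (hne : (C ∩ V).Nonempty) :
    C ⊆ V := by
  apply hC.subset_of_closure_inter_subset hV hne
  rintro z ⟨hz, hzC⟩
  by_contra hzV
  have : z ∈ C ∩ frontier V := ⟨hzC, by rw [hV.frontier_eq]; exact ⟨hz, hzV⟩⟩
  rw [hd] at this
  exact this

lemma ballfill {B : Set ℂ} (hB : IsOpen B) (hb : Bornology.IsBounded B) {p : ℂ} {r : ℝ}
    (hr : 0 < r) (hf : frontier B ⊆ ball p r) : B ⊆ ball p r := by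
  intro x hx
  by_contra hxr
  rw [mem_ball, not_lt, dist_eq_norm] at hxr
  set C : Set ℂ := (fun s : ℝ => p + (s : ℂ) * (x - p)) '' Ici 1 with hC
  have hCc : IsPreconnected C := isPreconnected_Ici.image _ (by fun_prop)
  have hsub := subset_of_no_frontier hCc hB (by
    rw [eq_empty_iff_forall_notMem]
    rintro _ ⟨⟨s, hs, rfl⟩, hz⟩
    have := hf hz
    rw [mem_ball, dist_eq_norm, add_sub_cancel_left, norm_mul, Complex.norm_real,
      Real.norm_of_nonneg (by linarith [mem_Ici.1 hs])] at this
    nlinarith [mem_Ici.1 hs, norm_nonneg (x - p)]) ⟨x, ⟨1, self_mem_Ici, by simp⟩, hx⟩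
  obtain ⟨M, hM⟩ := (hb.subset hsub).exists_norm_le
  obtain ⟨s, hs⟩ := exists_nat_gt ((M + ‖p‖) / r)
  rw [div_lt_iff₀ hr] at hs
  have h1 := hM (p + (((s : ℝ) + 1 : ℝ) : ℂ) * (x - p)) ⟨(s : ℝ) + 1, by simp, rfl⟩
  have h2 : ‖(((s : ℝ) + 1 : ℝ) : ℂ) * (x - p)‖ ≤
      ‖p + (((s : ℝ) + 1 : ℝ) : ℂ) * (x - p)‖ + ‖p‖ := by
    have := norm_sub_le (p + (((s : ℝ) + 1 : ℝ) : ℂ) * (x - p)) p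
    rwa [add_sub_cancel_left] at this
  rw [norm_mul, Complex.norm_real, Real.norm_of_nonneg (by positivity)] at h2
  have h3 : (s : ℝ) * r ≤ s * ‖x - p‖ := mul_le_mul_of_nonneg_left hxr (by positivity)
  nlinarith [norm_nonneg (x - p)]

lemma fill {K W : Set ℂ} (hK : IsCompact K) (hKc : IsPreconnected K) (hne : K.Nonempty)
    (hW : IsOpen W) (hWb : Bornology.IsBounded W) (hKW : K ⊆ W) :
    ∃ V L : Set ℂ, IsOpen V ∧ IsPreconnected V ∧ Bornology.IsBounded V ∧ K ⊆ V ∧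
      IsPreconnected L ∧ K ⊆ L ∧ L ⊆ W ∧ frontier V ⊆ L ∧ Full V ∧
      ∀ p r, 0 < r → W ⊆ ball p r → V ⊆ ball p r := by
  obtain ⟨δ, hδ, hδW⟩ := hK.exists_cthickening_subset_open hW hKW
  set G := thickening δ K with hG
  have hGo : IsOpen G := isOpen_thickening
  have hKG : K ⊆ G := self_subset_thickening hδ K
  have hclW : closure G ⊆ W := (closure_thickening_subset_cthickening δ K).trans hδW
  have hGW : G ⊆ W := subset_closure.trans hclW
  obtain ⟨y, hy⟩ := hne
  have hGc : IsPreconnected G := by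
    apply isPreconnected_of_forall y
    intro x hx
    obtain ⟨z, hz, hxz⟩ := mem_thickening_iff.1 hx
    refine ⟨K ∪ ball z δ, union_subset hKG ?_, Or.inl hy, Or.inr hxz,
      hKc.union z hz (mem_ball_self hδ) (convex_ball z δ).isPreconnected⟩
    exact ball_subset_thickening hz δ
  set V : Set ℂ := {x | ∃ B : Set ℂ, IsOpen B ∧ Bornology.IsBounded B ∧ frontier B ⊆ G ∧ x ∈ B}
    with hV
  have hBV : ∀ B : Set ℂ, IsOpen B → Bornology.IsBounded B → frontier B ⊆ G → B ⊆ V :=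
    fun B h1 h2 h3 x hx => ⟨B, h1, h2, h3, hx⟩
  have hGV : G ⊆ V := by
    intro x hx
    obtain ⟨ε, hε, hεG⟩ := Metric.nhds_basis_closedBall.mem_iff.1 (hGo.mem_nhds hx)
    exact ⟨ball x ε, isOpen_ball, isBounded_ball,
      (frontier_subset_closure.trans closure_ball_subset_closedBall).trans hεG, mem_ball_self hε⟩
  have hball : ∀ p r, 0 < r → W ⊆ ball p r → V ⊆ ball p r := by
    rintro p r hr hWr x ⟨B, h1, h2, h3, h4⟩
    exact ballfill h1 h2 hr (h3.trans (hGW.trans hWr)) h4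
  refine ⟨V, closure G, ?_, ?_, ?_, hKG.trans hGV, hGc.closure, hKG.trans subset_closure, hclW,
    ?_, ?_, hball⟩
  · rw [isOpen_iff_mem_nhds]
    rintro x ⟨B, h1, h2, h3, h4⟩
    exact mem_of_superset (h1.mem_nhds h4) (hBV B h1 h2 h3)
  · apply isPreconnected_of_forall y
    rintro x ⟨B, h1, h2, h3, h4⟩
    have hBG : B ∪ G ⊆ V := union_subset (hBV B h1 h2 h3) hGV
    have hxm : x ∈ connectedComponentIn (B ∪ G) x := mem_connectedComponentIn (Or.inl h4)
    have hsub := connectedComponentIn_subset (B ∪ G) x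
    by_cases hm : (connectedComponentIn (B ∪ G) x ∩ G).Nonempty
    · obtain ⟨w, hw1, hw2⟩ := hm
      exact ⟨connectedComponentIn (B ∪ G) x ∪ G, union_subset (hsub.trans hBG) hGV,
        Or.inr (hKG hy), Or.inl hxm,
        isPreconnected_connectedComponentIn.union w hw1 hw2 hGc⟩
    · exfalso
      set V' := connectedComponentIn (B ∪ G) x with hV'
      have hV'B : V' ⊆ B := by
        intro w hw
        rcases hsub hw with h | h
        · exact h
        · exact absurd ⟨w, hw, h⟩ hm
      have hcl : closure V' ⊆ B ∪ G := by
        refine (closure_mono hV'B).trans ?_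
        rw [closure_eq_self_union_frontier]
        exact union_subset_union_right _ h3
      have hcl2 : closure V' ⊆ V' :=
        isPreconnected_connectedComponentIn.closure.subset_connectedComponentIn
          (subset_closure hxm) hcl
      have hclopen : IsClopen V' :=
        ⟨closure_subset_iff_isClosed.1 hcl2, (h1.union hGo).connectedComponentIn⟩
      have huniv := hclopen.eq_univ ⟨x, hxm⟩
      have hb : Bornology.IsBounded (univ : Set ℂ) := huniv ▸ h2.subset hV'B
      exact NormedSpace.unbounded_univ ℂ ℂ hb
  · obtain ⟨r, hr, hWr⟩ := hWb.subset_ball_lt 0 0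
    exact isBounded_ball.subset (hball 0 r hr hWr)
  · intro z hz
    by_contra hzG
    obtain ⟨ε, hε, hεG⟩ := Metric.isOpen_iff.1 isClosed_closure.isOpen_compl z hzG
    have hVo : IsOpen V := by
      rw [isOpen_iff_mem_nhds]
      rintro x ⟨B, h1, h2, h3, h4⟩
      exact mem_of_superset (h1.mem_nhds h4) (hBV B h1 h2 h3)
    rw [hVo.frontier_eq] at hz
    obtain ⟨w, hw, B, h1, h2, h3, h4⟩ := mem_closure_iff.1 hz.1 _ isOpen_ball (mem_ball_self hε)
    have := subset_of_no_frontier (convex_ball z ε).isPreconnected h1 (by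
      rw [eq_empty_iff_forall_notMem]
      rintro q ⟨hq1, hq2⟩
      exact hεG hq1 (subset_closure (h3 hq2))) ⟨w, hw, h4⟩
    exact hz.2 ⟨B, h1, h2, h3, this (mem_ball_self hε)⟩
  · intro B' hB' hb' hf'
    have hcomp : IsCompact (frontier B') := Metric.isCompact_of_isClosed_isBounded
      isClosed_frontier (hb'.closure.subset frontier_subset_closure)
    obtain ⟨t, ht⟩ := hcomp.elim_finite_subcover
      (fun B : {B : Set ℂ // IsOpen B ∧ Bornology.IsBounded B ∧ frontier B ⊆ G} => B.1)
      (fun B => B.2.1) (by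
        intro z hz
        obtain ⟨B, h1, h2, h3, h4⟩ := hf' hz
        exact mem_iUnion.2 ⟨⟨B, h1, h2, h3⟩, h4⟩)
    set U := ⋃ i ∈ t, (i : Set ℂ) with hU
    have hUo : IsOpen U := isOpen_biUnion (fun B _ => B.2.1)
    have hUb : Bornology.IsBounded U :=
      (Bornology.isBounded_biUnion_finset t).2 (fun B _ => B.2.2.1)
    refine subset_union_left.trans (hBV (B' ∪ U) (hB'.union hUo) (hb'.union hUb) ?_)
    intro z hz
    rw [(hB'.union hUo).frontier_eq, closure_union] at hz
    obtain ⟨hz1, hz2⟩ := hz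
    have hzU : z ∉ U := fun h => hz2 (Or.inr h)
    rcases hz1 with h | h
    · exfalso
      apply hzU
      apply ht
      rw [hB'.frontier_eq]
      exact ⟨h, fun h => hz2 (Or.inl h)⟩
    · rw [hU, Finset.closure_biUnion] at h
      obtain ⟨B, hB, hzB⟩ := mem_iUnion₂.1 h
      apply B.2.2.2
      rw [B.2.1.frontier_eq]
      exact ⟨hzB, fun h => hzU (mem_iUnion₂.2 ⟨B, hB, h⟩)⟩

lemma diskfill {K W : Set ↥Disk} (hK : IsCompact K) (hKc : IsPreconnected K) (hne : K.Nonempty)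
    (hW : IsOpen W) (hKW : K ⊆ W) :
    ∃ V L : Set ↥Disk, IsOpenDisk V ∧ IsPreconnected V ∧ IsCompact (closure V) ∧ K ⊆ V ∧
      IsPreconnected L ∧ K ⊆ L ∧ L ⊆ W ∧ frontier V ⊆ L ∧
      ∀ p r, 0 < r → (∀ x ∈ W, x.1 ∈ ball p r) → ∀ x ∈ V, x.1 ∈ ball p r := by
  have hWD : Subtype.val '' W ⊆ Disk := by rintro _ ⟨x, -, rfl⟩; exact x.2
  obtain ⟨V, L, hVo, hVc, hVb, hKV, hLc, hKL, hLW, hfr, hfull, hball⟩ :=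
    fill (K := Subtype.val '' K) (W := Subtype.val '' W) (hK.image continuous_subtype_val)
      (hKc.image _ continuous_subtype_val.continuousOn) (hne.image _)
      (isOpen_ball.isOpenMap_subtype_val _ hW) (isBounded_ball.subset hWD) (image_mono hKW)
  have hVD : V ⊆ Disk := hball 0 1 one_pos hWD
  have hLD : L ⊆ Disk := hLW.trans hWD
  have himg : ∀ {S : Set ℂ}, S ⊆ Disk → Subtype.val '' (Subtype.val ⁻¹' S : Set ↥Disk) = S := by
    intro S hS
    rw [Subtype.image_preimage_coe]
    exact inter_eq_right.2 hS
  have hVX : IsOpen (Subtype.val ⁻¹' V : Set ↥Disk) := hVo.preimage continuous_subtype_val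
  have hclD : closure V ⊆ Disk := by
    rw [closure_eq_self_union_frontier]
    exact union_subset hVD (hfr.trans hLD)
  have hclcomp : IsCompact (closure V) := hVb.isCompact_closure
  have hclX : closure (Subtype.val ⁻¹' V : Set ↥Disk) ⊆ Subtype.val ⁻¹' (closure V) :=
    continuous_subtype_val.closure_preimage_subset V
  refine ⟨Subtype.val ⁻¹' V, Subtype.val ⁻¹' L, ⟨hVX, ?_⟩, ?_, ?_, ?_, ?_, ?_, ?_, ?_, ?_⟩
  · obtain ⟨e⟩ := riemann_map hVo hVc ((hne.image _).mono hKV) hVb (hasLog_of_full hVo hVc hfull)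
    have e1 := (Topology.IsEmbedding.subtypeVal (p := (· ∈ Disk))).homeomorphImage
      (Subtype.val ⁻¹' V : Set ↥Disk)
    exact ⟨(e1.trans (Homeomorph.setCongr (himg hVD))).trans e⟩
  · rw [← Topology.IsInducing.subtypeVal.isPreconnected_image, himg hVD]; exact hVc
  · apply IsCompact.of_isClosed_subset _ isClosed_closure hclX
    rw [Subtype.isCompact_iff, himg hclD]; exact hclcomp
  · exact image_subset_iff.1 hKV
  · rw [← Topology.IsInducing.subtypeVal.isPreconnected_image, himg hLD]; exact hLc
  · exact image_subset_iff.1 hKL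
  · intro x hx
    obtain ⟨y, hy, hyx⟩ := hLW hx
    rwa [← Subtype.ext hyx]
  · intro x hx
    rw [hVX.frontier_eq] at hx
    apply hfr
    rw [hVo.frontier_eq]
    exact ⟨hclX hx.1, hx.2⟩
  · intro p r hr hWr x hx
    exact hball p r hr (by rintro _ ⟨y, hy, rfl⟩; exact hWr y hy) hx

/-- not contained in a compact set -/
def Esc {X : Type*} [TopologicalSpace X] (C : Set X) : Prop := ∀ Q, IsCompact Q → ¬ C ⊆ Q

lemma Esc.mono {X : Type*} [TopologicalSpace X] {C D : Set X} (h : Esc C) (hCD : C ⊆ D) : Esc D :=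
  fun Q hQ hD => h Q hQ (hCD.trans hD)

lemma Esc.image {X : Type*} [TopologicalSpace X] {C : Set X} (h : Esc C) (f : X ≃ₜ X) :
    Esc (f '' C) := by
  intro Q hQ hD
  refine h (f ⁻¹' Q) (f.isCompact_preimage.2 hQ) (image_subset_iff.1 hD)

lemma esc_disj {X : Type*} [TopologicalSpace X] {C V L : Set X} (hC : IsPreconnected C)
    (hE : Esc C) (hV : IsOpen V) (hcl : IsCompact (closure V)) (hfr : frontier V ⊆ L)
    (hCL : C ∩ L = ∅) : C ∩ V = ∅ := by
  by_contra hcon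
  have h1 : C ∩ frontier V = ∅ := by
    apply subset_eq_empty (inter_subset_inter_right C hfr) hCL
  have := subset_of_no_frontier hC hV h1 (nonempty_iff_ne_empty.2 hcon)
  exact hE _ hcl (this.trans subset_closure)

lemma disj {X : Type*} [TopologicalSpace X] {V1 L1 V2 L2 C1 C2 : Set X} (hV1 : IsOpen V1)
    (hV2 : IsOpen V2) (hc1 : IsCompact (closure V1)) (hc2 : IsCompact (closure V2))
    (hV2c : IsPreconnected V2) (hL1 : IsPreconnected L1) (hC1 : IsPreconnected C1)
    (hC2 : IsPreconnected C2) (hE1 : Esc C1) (hE2 : Esc C2) (hf1 : frontier V1 ⊆ L1)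
    (hf2 : frontier V2 ⊆ L2) (hL : L1 ∩ L2 = ∅) (hCL : C1 ∩ L2 = ∅) (hCL' : C2 ∩ L1 = ∅)
    (hn1 : (C1 ∩ L1).Nonempty) (hn2 : (C2 ∩ V2).Nonempty) : V1 ∩ V2 = ∅ := by
  have h1 : C2 ∩ V1 = ∅ := esc_disj hC2 hE2 hV1 hc1 hf1 hCL'
  have h2 : (L1 ∪ C1) ∩ V2 = ∅ := by
    obtain ⟨x, hx1, hx2⟩ := hn1
    apply esc_disj (hL1.union x hx2 hx1 hC1) (hE1.mono subset_union_right) hV2 hc2 hf2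
    rw [union_inter_distrib_right, hL, hCL, union_empty]
  by_contra hcon
  have h3 : V2 ∩ frontier V1 = ∅ := by
    rw [eq_empty_iff_forall_notMem]
    rintro x ⟨hx1, hx2⟩
    have : x ∈ (L1 ∪ C1) ∩ V2 := ⟨Or.inl (hf1 hx2), hx1⟩
    rw [h2] at this; exact this
  have h4 := subset_of_no_frontier hV2c hV1 h3
    (by rw [inter_comm]; exact nonempty_iff_ne_empty.2 hcon)
  obtain ⟨x, hx1, hx2⟩ := hn2
  have : x ∈ C2 ∩ V1 := ⟨hx1, h4 hx2⟩
  rw [h1] at this; exact this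

lemma tendsto_cocompact_disk {F : Filter ℝ} {γ : ℝ → ↥Disk} {w : ℂ} (hw : w ∈ sphere (0 : ℂ) 1)
    (h : Tendsto (fun s => (γ s).1) F (𝓝 w)) : Tendsto γ F (cocompact ↥Disk) := by
  rw [(hasBasis_cocompact).tendsto_right_iff]
  intro Q hQ
  have hc : IsClosed (Subtype.val '' Q) := (hQ.image continuous_subtype_val).isClosed
  have hn : w ∉ Subtype.val '' Q := by
    rintro ⟨x, -, rfl⟩
    have h1 := x.2
    rw [mem_ball] at h1
    rw [mem_sphere] at hw
    linarith
  filter_upwards [h.eventually (hc.isOpen_compl.mem_nhds hn)] with s hs hsQ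
  exact hs ⟨_, hsQ, rfl⟩

lemma infDist_lt_of_disj {X : Type*} [MetricSpace X] {A B : Set X} (hB : IsClosed B)
    (hBn : B.Nonempty) (hAB : A ∩ B = ∅) {x : X} (hx : x ∈ A) : infDist x A < infDist x B := by
  rw [infDist_zero_of_mem hx]
  rw [← hB.notMem_iff_infDist_pos hBn]
  intro h
  have : x ∈ A ∩ B := ⟨hx, h⟩
  rw [hAB] at this; exact this

lemma inter_empty_of_infDist {X : Type*} [MetricSpace X] {A C L : Set X} {u : X → ℝ}
    (hu : ∀ x, 0 ≤ u x) (hCA : C ⊆ A) (hL : ∀ x ∈ L, u x < infDist x A) : C ∩ L = ∅ := by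
  rw [eq_empty_iff_forall_notMem]
  rintro x ⟨hx, hxL⟩
  have := hL x hxL
  rw [infDist_zero_of_mem (hCA hx)] at this
  linarith [hu x]

/-- Lemma 6.1. -/
theorem handel_lem_6_1 (f : ↥Disk ≃ₜ ↥Disk) (n : ℕ) (hn : 1 ≤ n)
    (Γ : ZMod n → ℝ → ↥Disk) (hcont : ∀ i, Continuous (Γ i))
    (α ω : ZMod n → ℂ)
    (hα : ∀ i, α i ∈ Metric.sphere (0:ℂ) 1) (hω : ∀ i, ω i ∈ Metric.sphere (0:ℂ) 1)
    (hαinj : Function.Injective α) (hωinj : Function.Injective ω)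
    (hαω : ∀ i j, α i ≠ ω j)
    (hlimₘ : ∀ i, Tendsto (fun s : ℝ => (Γ i s).1) atBot (nhds (α i)))
    (hlimₚ : ∀ i, Tendsto (fun s : ℝ => (Γ i s).1) atTop (nhds (ω i)))
    (hfree : ∀ i, ∀ s s' : ℝ, s' ≤ s → f (Γ i s) ≠ Γ i s')
    (t : ZMod n → ℤ → ℝ) (hmono : ∀ i, StrictMono (t i))
    (htbot : ∀ i, Tendsto (t i) atBot atBot) (httop : ∀ i, Tendsto (t i) atTop atTop)
    (hsep : ∀ i i', i' ≠ i → (Γ i '' Set.Ici (t i 1)) ∩ Set.range (Γ i') = ∅)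
    (hsep' : ∀ i, (Γ i '' Set.Ici (t i 1)) ∩ (Γ i '' Set.Iic (t i 0)) = ∅) :
    ∃ V : ZMod n → ℤ → Set ↥Disk,
      (∀ i, ∀ l : ℤ, l ≠ 0 → IsOpenDisk (V i l)) ∧
      (∀ i, ∀ l : ℤ, l ≠ 0 → Γ i '' Set.Icc (t i l) (t i (l + 1)) ⊆ V i l) ∧
      (∀ i i', i ≠ i' → ∀ l l' : ℤ, 0 < l → l' ≠ 0 → V i l ∩ V i' l' = ∅) ∧
      (∀ i, ∀ l l' : ℤ, l' < 0 → 0 < l → V i l ∩ V i l' = ∅) ∧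
      (∀ i, ∀ l l' : ℤ, l ≠ 0 → l' ≠ 0 → l' < l → (⇑f '' V i l) ∩ V i l' = ∅) ∧
      (∀ i, ∀ ε > (0 : ℝ), ∃ N : ℤ, ∀ l ≥ N, ∀ x ∈ closure (V i l), dist x.1 (ω i) < ε) ∧
      (∀ i, ∀ ε > (0 : ℝ), ∃ N : ℤ, ∀ l ≤ N, ∀ x ∈ closure (V i l), dist x.1 (α i) < ε) := by
  have : NeZero n := ⟨by omega⟩
  -- properness
  have hclosed : ∀ i, ∀ S : Set ℝ, IsClosed S → IsClosed (Γ i '' S) := by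
    intro i
    have hp : IsProperMap (Γ i) := by
      rw [isProperMap_iff_tendsto_cocompact]
      refine ⟨hcont i, ?_⟩
      rw [cocompact_eq_atBot_atTop]
      exact (tendsto_cocompact_disk (hα i) (hlimₘ i)).sup (tendsto_cocompact_disk (hω i) (hlimₚ i))
    exact fun S hS => hp.isClosedMap S hS
  have hescI : ∀ i a, Esc (Γ i '' Ici a) := by
    intro i a Q hQ hsub
    have h1 := (tendsto_cocompact_disk (hω i) (hlimₚ i)).eventually hQ.compl_mem_cocompact
    obtain ⟨s, hs1, hs2⟩ := (h1.and (eventually_ge_atTop a)).exists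
    exact hs1 (hsub ⟨s, hs2, rfl⟩)
  have hescO : ∀ i a, Esc (Γ i '' Iic a) := by
    intro i a Q hQ hsub
    have h1 := (tendsto_cocompact_disk (hα i) (hlimₘ i)).eventually hQ.compl_mem_cocompact
    obtain ⟨s, hs1, hs2⟩ := (h1.and (eventually_le_atBot a)).exists
    exact hs1 (hsub ⟨s, hs2, rfl⟩)
  have hpcI : ∀ i a, IsPreconnected (Γ i '' Ici a) := fun i a =>
    isPreconnected_Ici.image _ (hcont i).continuousOn
  have hpcO : ∀ i a, IsPreconnected (Γ i '' Iic a) := fun i a =>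
    isPreconnected_Iic.image _ (hcont i).continuousOn
  set K : ZMod n → ℤ → Set ↥Disk := fun i l => Γ i '' Icc (t i l) (t i (l + 1)) with hKdef
  set A : ZMod n → Set ↥Disk := fun i => Γ i '' Ici (t i 1) with hAdef
  set B : ZMod n → Set ↥Disk := fun i => Γ i '' Iic (t i 0) ∪ ⋃ j : {j // j ≠ i}, range (Γ j.1)
    with hBdef
  have htle : ∀ i, ∀ l l' : ℤ, l ≤ l' → t i l ≤ t i l' := fun i l l' h => (hmono i).monotone h
  have hKc : ∀ i l, IsCompact (K i l) := fun i l => isCompact_Icc.image (hcont i)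
  have hKp : ∀ i l, IsPreconnected (K i l) := fun i l =>
    isPreconnected_Icc.image _ (hcont i).continuousOn
  have hKn : ∀ i l, (K i l).Nonempty := fun i l =>
    (nonempty_Icc.2 (htle i l (l + 1) (by omega))).image _
  have hKI : ∀ i (l l' : ℤ), l' ≤ l → K i l ⊆ Γ i '' Ici (t i l') := fun i l l' h =>
    image_mono (fun s hs => (htle i l' l h).trans hs.1)
  have hKO : ∀ i (l l' : ℤ), l + 1 ≤ l' → K i l ⊆ Γ i '' Iic (t i l') := fun i l l' h =>
    image_mono (fun s hs => le_trans hs.2 (htle i (l + 1) l' h))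
  have hAc : ∀ i, IsClosed (A i) := fun i => hclosed i _ isClosed_Ici
  have hAn : ∀ i, (A i).Nonempty := fun i => ⟨_, _, self_mem_Ici, rfl⟩
  have hBc : ∀ i, IsClosed (B i) := fun i => (hclosed i _ isClosed_Iic).union
    (isClosed_iUnion_of_finite (fun j => by
      rw [← image_univ]; exact hclosed j.1 _ isClosed_univ))
  have hBn : ∀ i, (B i).Nonempty := fun i => ⟨_, Or.inl ⟨_, self_mem_Iic, rfl⟩⟩
  have hAB : ∀ i, A i ∩ B i = ∅ := by
    intro i
    rw [hAdef, hBdef]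
    simp only
    rw [inter_union_distrib_left, hsep' i, empty_union, inter_iUnion, iUnion_eq_empty]
    rintro ⟨j, hj⟩
    exact hsep i j hj
  have hBA : ∀ i, B i ∩ A i = ∅ := fun i => by rw [inter_comm]; exact hAB i
  -- where curves live
  have hOB : ∀ i i0 (a : ℝ), (i ≠ i0 ∨ a ≤ t i 0) → Γ i '' Iic a ⊆ B i0 := by
    intro i i0 a h
    by_cases hi : i = i0
    · subst hi
      rcases h with h | h
      · exact absurd rfl h
      · exact (image_mono (Iic_subset_Iic.2 h)).trans subset_union_left
    · refine (image_subset_range _ _).trans ?_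
      refine subset_trans ?_ subset_union_right
      exact subset_iUnion (fun j : {j // j ≠ i0} => range (Γ j.1)) ⟨i, hi⟩
  set W : ZMod n → ℤ → Set ↥Disk := fun i l =>
    ({x | infDist x (K i l) < 1 / (|(l : ℝ)| + 1)} ∩
      {x | infDist x (K i l) < infDist x (f '' (Γ i '' Ici (t i (l + 1))))}) ∩
    ({x | infDist (f x) (f '' K i l) < infDist (f x) (Γ i '' Iic (t i l))} ∩
      ⋂ i0, {x | (i = i0 ∧ 0 < l → infDist x (A i0) < infDist x (B i0)) ∧
        (¬ (i = i0 ∧ 0 < l) → infDist x (B i0) < infDist x (A i0))}) with hWdef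
  have hdc : ∀ S : Set ↥Disk, Continuous (fun x => infDist x S) := fun S => continuous_infDist_pt S
  have hWo : ∀ i l, IsOpen (W i l) := by
    intro i l
    refine (IsOpen.inter (isOpen_lt (hdc _) continuous_const) (isOpen_lt (hdc _) (hdc _))).inter
      (IsOpen.inter (isOpen_lt ((hdc _).comp f.continuous) ((hdc _).comp f.continuous)) ?_)
    apply isOpen_iInter_of_finite
    intro i0
    by_cases h : i = i0 ∧ 0 < l
    · have : {x : ↥Disk | (i = i0 ∧ 0 < l → infDist x (A i0) < infDist x (B i0)) ∧
        (¬ (i = i0 ∧ 0 < l) → infDist x (B i0) < infDist x (A i0))} =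
          {x | infDist x (A i0) < infDist x (B i0)} := by
        ext x
        exact ⟨fun hx => hx.1 h, fun hx => ⟨fun _ => hx, fun h' => absurd h h'⟩⟩
      rw [this]
      exact isOpen_lt (hdc _) (hdc _)
    · have : {x : ↥Disk | (i = i0 ∧ 0 < l → infDist x (A i0) < infDist x (B i0)) ∧
        (¬ (i = i0 ∧ 0 < l) → infDist x (B i0) < infDist x (A i0))} =
          {x | infDist x (B i0) < infDist x (A i0)} := by
        ext x
        exact ⟨fun hx => hx.2 h, fun hx => ⟨fun h' => absurd h' h, fun _ => hx⟩⟩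
      rw [this]
      exact isOpen_lt (hdc _) (hdc _)
  have hfcl : ∀ i a, IsClosed (f '' (Γ i '' Ici a)) := fun i a =>
    f.isClosedMap _ (hclosed i _ isClosed_Ici)
  have hKW : ∀ i l, l ≠ 0 → K i l ⊆ W i l := by
    intro i l hl x hx
    refine ⟨⟨?_, ?_⟩, ?_, ?_⟩
    · change infDist x (K i l) < _
      rw [infDist_zero_of_mem hx]; positivity
    · apply infDist_lt_of_disj (hfcl _ _) ⟨_, _, ⟨_, self_mem_Ici, rfl⟩, rfl⟩ _ hx
      rw [eq_empty_iff_forall_notMem]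
      rintro _ ⟨⟨s', hs', rfl⟩, _, ⟨s, hs, rfl⟩, he⟩
      exact hfree i s s' (hs'.2.trans hs) he
    · apply infDist_lt_of_disj (hclosed i _ isClosed_Iic) ⟨_, _, self_mem_Iic, rfl⟩ _ (mem_image_of_mem f hx)
      rw [eq_empty_iff_forall_notMem]
      rintro _ ⟨⟨_, ⟨s, hs, rfl⟩, rfl⟩, s', hs', he⟩
      exact hfree i s s' (le_trans hs' hs.1) he.symm
    · rw [mem_iInter]
      intro i0
      refine ⟨fun h => ?_, fun h => ?_⟩
      · obtain ⟨rfl, h⟩ := h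
        exact infDist_lt_of_disj (hBc i) (hBn i) (hAB i) (hKI i l 1 (by omega) hx)
      · apply infDist_lt_of_disj (hAc i0) (hAn i0) (hBA i0)
        refine hOB i i0 (t i (l + 1)) ?_ (hKO i l (l + 1) le_rfl hx)
        by_cases hi : i = i0
        · right
          have : ¬ 0 < l := fun h' => h ⟨hi, h'⟩
          exact htle i _ _ (by omega)
        · left; exact hi
  have hex : ∀ i l, ∃ V L : Set ↥Disk, l ≠ 0 → IsOpenDisk V ∧ IsPreconnected V ∧
      IsCompact (closure V) ∧ K i l ⊆ V ∧
      IsPreconnected L ∧ K i l ⊆ L ∧ L ⊆ W i l ∧ frontier V ⊆ L ∧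
      ∀ p r, 0 < r → (∀ x ∈ W i l, x.1 ∈ ball p r) → ∀ x ∈ V, x.1 ∈ ball p r := by
    intro i l
    by_cases hl : l = 0
    · exact ⟨∅, ∅, fun h => absurd hl h⟩
    · obtain ⟨V, L, h⟩ := diskfill (hKc i l) (hKp i l) (hKn i l) (hWo i l) (hKW i l hl)
      exact ⟨V, L, fun _ => h⟩
  choose V L hVL using hex
  have hsepV : ∀ i i' (l l' : ℤ), 0 < l → l' ≠ 0 → (i' ≠ i ∨ l' < 0) → V i l ∩ V i' l' = ∅ := by
    intro i i' l l' hl hl' hor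
    obtain ⟨⟨o1, -⟩, p1, c1, k1, q1, m1, w1, f1, -⟩ := hVL i l (by omega)
    obtain ⟨⟨o2, -⟩, p2, c2, k2, q2, m2, w2, f2, -⟩ := hVL i' l' hl'
    have hL1 : ∀ x ∈ L i l, infDist x (A i) < infDist x (B i) := fun x hx =>
      (mem_iInter.1 (w1 hx).2.2 i).1 ⟨rfl, hl⟩
    have hL2 : ∀ x ∈ L i' l', infDist x (B i) < infDist x (A i) := fun x hx =>
      (mem_iInter.1 (w2 hx).2.2 i).2 (by
        rintro ⟨h1, h2⟩
        rcases hor with h | h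
        · exact h h1
        · omega)
    refine disj (C1 := Γ i '' Ici (t i l)) (C2 := Γ i' '' Iic (t i' (l' + 1))) o1 o2 c1 c2 p2 q1
      (hpcI _ _) (hpcO _ _) (hescI _ _) (hescO _ _) f1 f2 ?_ ?_ ?_ ?_ ?_
    · rw [eq_empty_iff_forall_notMem]
      rintro x ⟨h1, h2⟩
      exact lt_asymm (hL1 x h1) (hL2 x h2)
    · exact inter_empty_of_infDist (fun x => infDist_nonneg)
        (image_mono (Ici_subset_Ici.2 (htle i 1 l (by omega)))) hL2
    · refine inter_empty_of_infDist (fun x => infDist_nonneg) (hOB i' i _ ?_) hL1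
      rcases hor with h | h
      · exact Or.inl h
      · exact Or.inr (htle _ _ _ (by omega))
    · have hm : Γ i (t i l) ∈ K i l := ⟨_, left_mem_Icc.2 (htle i _ _ (by omega)), rfl⟩
      exact ⟨_, hKI i l l le_rfl hm, m1 hm⟩
    · have hm : Γ i' (t i' l') ∈ K i' l' := ⟨_, left_mem_Icc.2 (htle i' _ _ (by omega)), rfl⟩
      exact ⟨_, hKO i' l' _ le_rfl hm, k2 hm⟩
  have hconv : ∀ i (l : ℤ) (w : ℂ) (ε : ℝ), l ≠ 0 → 0 < ε → 1 / (|(l : ℝ)| + 1) < ε / 3 →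
      (∀ y ∈ K i l, dist y.1 w < ε / 3) → ∀ x ∈ closure (V i l), dist x.1 w < ε := by
    intro i l w ε hl hε h1 h2 x hx
    obtain ⟨-, -, -, -, -, -, -, -, hb⟩ := hVL i l hl
    have h3 := hb w (2 * ε / 3) (by positivity) (by
      intro x hx
      have h4 : infDist x (K i l) < ε / 3 := lt_trans hx.1.1 h1
      obtain ⟨y, hy, hxy⟩ := (infDist_lt_iff (hKn i l)).1 h4
      rw [Subtype.dist_eq] at hxy
      rw [mem_ball]
      linarith [dist_triangle x.1 y.1 w, h2 y hy])
    have h5 : closure (V i l) ⊆ {x | dist x.1 w ≤ 2 * ε / 3} := by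
      apply closure_minimal
      · intro x hx; exact (mem_ball.1 (h3 x hx)).le
      · exact isClosed_le (continuous_subtype_val.dist continuous_const) continuous_const
    have : dist x.1 w ≤ 2 * ε / 3 := h5 hx
    linarith
  have hsmall : ∀ ε : ℝ, 0 < ε → ∃ N : ℤ, 0 < N ∧ ∀ l : ℤ, N ≤ |l| → 1 / (|(l : ℝ)| + 1) < ε := by
    intro ε hε
    obtain ⟨N, hN⟩ := exists_nat_gt (1 / ε)
    refine ⟨N + 1, by positivity, fun l hl => ?_⟩
    have h1 : ((N : ℝ) + 1) ≤ |(l : ℝ)| := by exact_mod_cast hl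
    rw [div_lt_iff₀ (by positivity)]
    rw [div_lt_iff₀ hε] at hN
    nlinarith
  refine ⟨V, fun i l hl => (hVL i l hl).1, fun i l hl => (hVL i l hl).2.2.2.1, ?_, ?_, ?_, ?_, ?_⟩
  · intro i i' hi l l' hl hl'
    exact hsepV i i' l l' hl hl' (Or.inl hi.symm)
  · intro i l l' hl' hl
    exact hsepV i i l l' hl hl'.ne (Or.inr hl')
  · intro i l l' hl hl' hll
    obtain ⟨⟨o1, -⟩, p1, c1, k1, q1, m1, w1, f1, -⟩ := hVL i l hl
    obtain ⟨⟨o2, -⟩, p2, c2, k2, q2, m2, w2, f2, -⟩ := hVL i l' hl'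
    have hL1 : ∀ y ∈ f '' L i l, infDist y (f '' K i l) < infDist y (Γ i '' Iic (t i l)) := by
      rintro _ ⟨x, hx, rfl⟩
      exact (w1 hx).2.1
    have hL2 : ∀ x ∈ L i l', infDist x (K i l') < infDist x (f '' (Γ i '' Ici (t i (l' + 1)))) :=
      fun x hx => (w2 hx).1.2
    have hm : Γ i (t i l) ∈ K i l := ⟨_, left_mem_Icc.2 (htle i _ _ (by omega)), rfl⟩
    have hm' : Γ i (t i l') ∈ K i l' := ⟨_, left_mem_Icc.2 (htle i _ _ (by omega)), rfl⟩
    refine disj (L1 := f '' L i l) (C1 := f '' (Γ i '' Ici (t i l)))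
      (C2 := Γ i '' Iic (t i (l' + 1))) (f.isOpenMap _ o1) o2 ?_ c2 p2
      (q1.image _ f.continuous.continuousOn)
      ((hpcI _ _).image _ f.continuous.continuousOn) (hpcO _ _) ((hescI _ _).image f) (hescO _ _)
      ?_ f2 ?_ ?_ ?_ ?_ ?_
    · rw [← f.image_closure]; exact c1.image f.continuous
    · rw [← f.image_frontier]; exact image_mono f1
    · rw [eq_empty_iff_forall_notMem]
      rintro y ⟨h1, h2⟩
      have a1 := hL1 y h1
      have a2 := hL2 y h2
      have a3 : infDist y (f '' (Γ i '' Ici (t i (l' + 1)))) ≤ infDist y (f '' K i l) :=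
        infDist_le_infDist_of_subset (image_mono (hKI i l (l' + 1) (by omega))) ((hKn i l).image _)
      have a4 : infDist y (Γ i '' Iic (t i l)) ≤ infDist y (K i l') :=
        infDist_le_infDist_of_subset (hKO i l' l (by omega)) (hKn i l')
      linarith
    · exact inter_empty_of_infDist (fun x => infDist_nonneg)
        (image_mono (image_mono (Ici_subset_Ici.2 (htle i (l' + 1) l (by omega))))) hL2
    · exact inter_empty_of_infDist (fun x => infDist_nonneg)
        (image_mono (Iic_subset_Iic.2 (htle i (l' + 1) l (by omega)))) hL1
    · exact ⟨_, ⟨_, hKI i l l le_rfl hm, rfl⟩, ⟨_, m1 hm, rfl⟩⟩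
    · exact ⟨_, hKO i l' _ le_rfl hm', k2 hm'⟩
  · intro i ε hε
    obtain ⟨N, hN0, hN⟩ := hsmall (ε / 3) (by positivity)
    have h1 := (hlimₚ i).eventually (ball_mem_nhds (ω i) (show 0 < ε / 3 by positivity))
    obtain ⟨s0, hs0⟩ := eventually_atTop.1 h1
    obtain ⟨M, hM⟩ := eventually_atTop.1 ((httop i).eventually (eventually_ge_atTop s0))
    refine ⟨max N M, fun l hl => ?_⟩
    have hlN : N ≤ l := (le_max_left _ _).trans hl
    have hlM : M ≤ l := (le_max_right _ _).trans hl
    apply hconv i l (ω i) ε (by omega) hε (hN l (hlN.trans (le_abs_self l)))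
    rintro _ ⟨s, hs, rfl⟩
    exact hs0 s ((hM l hlM).trans hs.1)
  · intro i ε hε
    obtain ⟨N, hN0, hN⟩ := hsmall (ε / 3) (by positivity)
    have h1 := (hlimₘ i).eventually (ball_mem_nhds (α i) (show 0 < ε / 3 by positivity))
    obtain ⟨s0, hs0⟩ := eventually_atBot.1 h1
    obtain ⟨M, hM⟩ := eventually_atBot.1 ((htbot i).eventually (eventually_le_atBot s0))
    refine ⟨min (-N) (M - 1), fun l hl => ?_⟩
    have hlN : l ≤ -N := hl.trans (min_le_left _ _)
    have hlM : l ≤ M - 1 := hl.trans (min_le_right _ _)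
    apply hconv i l (α i) ε (by omega) hε (hN l (by rw [abs_of_neg (by omega)]; omega))
    rintro _ ⟨s, hs, rfl⟩
    exact hs0 s (le_trans hs.2 (hM (l + 1) (by omega)))
end
end

section
/- Let n ≥ 2 and let α_1, …, α_n, ω_1, …, ω_n be 2n pairwise distinct points of the unit circle S¹ ⊂ ℂ. For each i, let Δ_i be the real affine line through α_i and ω_i, and set Π_i^+ = {z ∈ ℂ : Im((z−α_i)/(ω_i−α_i)) > 0} and Π_i^- = {z ∈ ℂ : Im((z−α_i)/(ω_i−α_i)) < 0}. Assume: (a) no point of ℂ lies on Δ_i ∩ Δ_j ∩ Δ_k for pairwise distinct i, j, k; (b) for all i ≠ j, each of the two open arcs of S¹ with endpoints α_i and α_j contains some point ω_k, and each of the two open arcs of S¹ with endpoints ω_i and ω_j contains some point α_k; (c) for every i there exists i' ≠ i such that α_i and ω_i lie in different connected components of S¹ ∖ {α_{i'}, ω_{i'}}. Then there exists a nonempty subset I ⊆ {1, …, n} such that at least one of the convex open sets ⋂_{i∈I} Π_i^+ or ⋂_{i∈I} Π_i^- is nonempty and relatively compact in the open unit disk 𝔻, i.e. its closure is compact and contained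 in {z ∈ ℂ : |z| < 1}. (Claim proved in Remark (2) of the introduction.) -/
open Set Metric Complex

noncomputable section

/-- The real affine line of `ℂ` through `a` and `b`. -/
def lineThru (a b : ℂ) : Set ℂ := {z | ∃ s : ℝ, z = a + s • (b - a)}

/-- The open half plane strictly to the left of the oriented line from `a` to `b`. -/
def halfPlanePos (a b : ℂ) : Set ℂ := {z | 0 < ((z - a) / (b - a)).im}

/-- The open half plane strictly to the right of the oriented line from `a` to `b`. -/
def halfPlaneNeg (a b : ℂ) : Set ℂ := {z | ((z - a) / (b - a)).im < 0}

lemma exp_sub_exp (x a : ℝ) : exp (x * I) - exp (a * I) =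
    exp ((x + a) / 2 * I) * (2 * I * (Real.sin ((x - a) / 2) : ℂ)) := by
  have h1 : exp ((x:ℂ) * I) = exp ((x + a) / 2 * I) * exp ((x - a) / 2 * I) := by
    rw [← Complex.exp_add]; congr 1; ring
  have h2 : exp ((a:ℂ) * I) = exp ((x + a) / 2 * I) * exp (-((x - a) / 2) * I) := by
    rw [← Complex.exp_add]; congr 1; ring
  rw [h1, h2]
  push_cast
  rw [Complex.sin]
  linear_combination (- exp ((x + a) / 2 * I) * (exp (-((x - a) / 2) * I) - exp ((x - a) / 2 * I))) * I_sq

lemma sign_sin_half {u v : ℝ} (hu : u ∈ Ico 0 (2 * Real.pi)) (hv : v ∈ Ico 0 (2 * Real.pi)) :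
    SignType.sign (Real.sin ((u - v) / 2)) = SignType.sign (u - v) := by
  obtain ⟨hu0, hu1⟩ := hu
  obtain ⟨hv0, hv1⟩ := hv
  rcases lt_trichotomy u v with h | h | h
  · rw [sign_neg (sub_neg.2 h), sign_neg]
    apply Real.sin_neg_of_neg_of_neg_pi_lt <;> linarith
  · simp [h]
  · rw [sign_pos (sub_pos.2 h), sign_pos]
    apply Real.sin_pos_of_pos_of_lt_pi <;> linarith

lemma sign_inv_real (x : ℝ) : SignType.sign x⁻¹ = SignType.sign x := by
  rcases lt_trichotomy x 0 with h | h | h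
  · rw [sign_neg h, sign_neg (inv_lt_zero.2 h)]
  · simp [h]
  · rw [sign_pos h, sign_pos (inv_pos.2 h)]

lemma sign_im {w : ℂ} (hw : w ≠ 0) {x a o : ℝ} (hx : x ∈ Ico 0 (2 * Real.pi))
    (ha : a ∈ Ico 0 (2 * Real.pi)) (ho : o ∈ Ico 0 (2 * Real.pi)) (hao : a ≠ o) :
    SignType.sign (((w * exp (x * I) - w * exp (a * I)) /
      (w * exp (o * I) - w * exp (a * I))).im) =
    SignType.sign ((o - a) * (x - o) * (x - a)) := by
  have hs : Real.sin ((o - a) / 2) ≠ 0 := by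
    rw [← sign_ne_zero, sign_sin_half ho ha, sign_ne_zero, sub_ne_zero]
    exact hao.symm
  have hs' : (Real.sin ((o - a) / 2) : ℂ) ≠ 0 := by exact_mod_cast hs
  have key : (w * exp (x * I) - w * exp (a * I)) / (w * exp (o * I) - w * exp (a * I)) =
      ((Real.sin ((x - a) / 2) * (Real.sin ((o - a) / 2))⁻¹ : ℝ) : ℂ) *
        exp (((x - o) / 2 : ℝ) * I) := by
    rw [← mul_sub, ← mul_sub, mul_div_mul_left _ _ hw, exp_sub_exp, exp_sub_exp, div_eq_iff]
    · have : exp (((x:ℂ) + a) / 2 * I) = exp (((x - o) / 2 : ℝ) * I) * exp (((o:ℂ) + a) / 2 * I) := by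
        rw [← Complex.exp_add]; congr 1; push_cast; ring
      rw [this, Complex.ofReal_mul, Complex.ofReal_inv]
      field_simp
    · exact mul_ne_zero (Complex.exp_ne_zero _) (mul_ne_zero (mul_ne_zero two_ne_zero I_ne_zero) hs')
  rw [key, Complex.im_ofReal_mul, Complex.exp_ofReal_mul_I_im]
  simp only [sign_mul, sign_inv_real]
  rw [sign_sin_half hx ha, sign_sin_half ho ha, sign_sin_half hx ho, mul_assoc, mul_comm]

lemma exists_angle {w u : ℂ} (hw : w ∈ sphere (0:ℂ) 1) (hu : u ∈ sphere (0:ℂ) 1) :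
    ∃ t ∈ Ico 0 (2 * Real.pi), u = w * exp ((t : ℝ) * I) := by
  have hw' : ‖w‖ = 1 := by simpa using hw
  have hu' : ‖u‖ = 1 := by simpa using hu
  have hw0 : w ≠ 0 := by rintro rfl; simp at hw'
  refine ⟨toIcoMod Real.two_pi_pos 0 (u / w).arg, ?_, ?_⟩
  · simpa using toIcoMod_mem_Ico Real.two_pi_pos 0 (u / w).arg
  · have h1 : exp ((toIcoMod Real.two_pi_pos 0 (u / w).arg : ℝ) * I) = exp ((u / w).arg * I) := by
      rw [toIcoMod, Complex.exp_eq_exp_iff_exists_int]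
      refine ⟨- toIcoDiv Real.two_pi_pos 0 (u / w).arg, ?_⟩
      push_cast
      simp
      ring
    have h2 := Complex.norm_mul_exp_arg_mul_I (u / w)
    rw [norm_div, hw', hu'] at h2
    rw [h1]
    simp at h2
    rw [h2]; field_simp

lemma mem_sphere_exp {w : ℂ} (hw : w ∈ sphere (0:ℂ) 1) (t : ℝ) : w * exp (t * I) ∈ sphere (0:ℂ) 1 := by
  have hw' : ‖w‖ = 1 := by simpa using hw
  simp [hw', Complex.norm_exp_ofReal_mul_I]

lemma sphere_ne_zero {w : ℂ} (hw : w ∈ sphere (0:ℂ) 1) : w ≠ 0 := by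
  rintro rfl; simp at hw

/-- points in the same component lie on the same side -/
lemma sign_comp {a b x y : ℂ} (ha : a ∈ sphere (0:ℂ) 1) (hb : b ∈ sphere (0:ℂ) 1) (hab : a ≠ b)
    (hx : x ∈ sphere (0:ℂ) 1 \ {a, b})
    (hy : y ∈ connectedComponentIn (sphere (0:ℂ) 1 \ {a, b}) x)
    (hneg : ((x - a) / (b - a)).im < 0) : ((y - a) / (b - a)).im < 0 := by
  by_contra hcon
  push Not at hcon
  have hpre : IsPreconnected (connectedComponentIn (sphere (0:ℂ) 1 \ {a, b}) x) :=
    isPreconnected_connectedComponentIn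
  have hcont : ContinuousOn (fun z : ℂ => ((z - a) / (b - a)).im)
      (connectedComponentIn (sphere (0:ℂ) 1 \ {a, b}) x) := by fun_prop
  obtain ⟨z, hz, hz0⟩ := hpre.intermediate_value (mem_connectedComponentIn hx) hy hcont
    (show (0:ℝ) ∈ Icc _ _ from ⟨hneg.le, hcon⟩)
  have hz' := connectedComponentIn_subset _ _ hz
  obtain ⟨hzs, hzn⟩ := hz'
  obtain ⟨s, hs, rfl⟩ := exists_angle ha hzs
  obtain ⟨o, ho, rfl⟩ := exists_angle ha hb
  have h00 : (0:ℝ) ∈ Ico 0 (2 * Real.pi) := ⟨le_rfl, Real.two_pi_pos⟩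
  have ho0 : 0 ≠ o := by rintro rfl; simp at hab
  have := sign_im (sphere_ne_zero ha) hs h00 ho ho0
  simp only [ofReal_zero, zero_mul, Complex.exp_zero, mul_one] at this
  simp only at hz0
  rw [hz0, sign_zero, eq_comm, sign_eq_zero_iff] at this
  apply hzn
  simp only [sub_zero, mul_eq_zero, sub_eq_zero] at this
  rcases this with (h | h) | h
  · exact absurd h.symm ho0
  · right; rw [h]; rfl
  · left; simp [h]

lemma halfPlaneNeg_eq {a b : ℂ} (hab : a ≠ b) : halfPlaneNeg a b = halfPlanePos b a := by
  have h1 : b - a ≠ 0 := sub_ne_zero.2 hab.symm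
  have h2 : a - b ≠ 0 := sub_ne_zero.2 hab
  ext z
  have : (z - b) / (a - b) = 1 - (z - a) / (b - a) := by
    rw [eq_sub_iff_add_eq, div_add_div _ _ h2 h1, div_eq_one_iff_eq (mul_ne_zero h2 h1)]; ring
  simp [halfPlaneNeg, halfPlanePos, this]

lemma key_compact {n : ℕ} (α ω : Fin n → ℂ) (I : Set (Fin n)) (p : ℂ) (hp : p ∈ ball (0:ℂ) 1)
    (hpI : ∀ i ∈ I, 0 < ((p - α i) / (ω i - α i)).im)
    (hS : ∀ z ∈ sphere (0:ℂ) 1, ∃ i ∈ I, ((z - α i) / (ω i - α i)).im < 0) :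
    (⋂ i ∈ I, halfPlanePos (α i) (ω i)).Nonempty ∧
          IsCompact (closure (⋂ i ∈ I, halfPlanePos (α i) (ω i))) ∧
          closure (⋂ i ∈ I, halfPlanePos (α i) (ω i)) ⊆ Metric.ball (0:ℂ) 1 := by
  set U := ⋂ i ∈ I, halfPlanePos (α i) (ω i) with hU
  have hpU : p ∈ U := by simpa [hU, halfPlanePos] using hpI
  have hconv : Convex ℝ U := by
    refine convex_iInter₂ fun i _ => ?_
    intro x hx y hy s t hs ht hst
    simp only [halfPlanePos, mem_ofPred_eq] at *
    have : (s • x + t • y - α i) / (ω i - α i) =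
        s * ((x - α i) / (ω i - α i)) + t * ((y - α i) / (ω i - α i)) := by
      have h' : (s:ℂ) + t = 1 := by exact_mod_cast hst
      rw [← mul_div_assoc, ← mul_div_assoc, ← add_div]
      congr 1
      simp only [real_smul]
      linear_combination (α i) * h'
    rw [this, add_im, im_ofReal_mul, im_ofReal_mul]
    rcases hs.eq_or_lt with rfl | hs
    · have : t = 1 := by linarith
      subst this; simpa using hy
    · have := mul_pos hs hx
      have := mul_nonneg ht hy.le
      linarith
  have hcl : closure U ⊆ {z | ∀ i ∈ I, 0 ≤ ((z - α i) / (ω i - α i)).im} := by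
    apply closure_minimal
    · intro z hz i hi
      simp only [hU, mem_iInter] at hz
      exact (hz i hi).le
    · simp only [ofPred_forall]
      refine isClosed_biInter fun i _ => isClosed_le continuous_const (by fun_prop)
  have hsub : closure U ⊆ ball (0:ℂ) 1 := by
    intro y hy
    by_contra hyb
    obtain ⟨z, hz, hz1⟩ := hconv.closure.isPreconnected.intermediate_value (subset_closure hpU) hy
      (continuous_norm.continuousOn) (show (1:ℝ) ∈ Icc _ _ from
        ⟨by simpa using (mem_ball_zero_iff.1 hp).le, by simpa using hyb⟩)
    obtain ⟨i, hi, h⟩ := hS z (by simpa using hz1)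
    exact absurd (hcl hz i hi) (not_le.2 h)
  refine ⟨⟨p, hpU⟩, ?_, hsub⟩
  exact Metric.isCompact_of_isClosed_isBounded isClosed_closure (isBounded_ball.subset hsub)

open Classical in
lemma count_le {n : ℕ} (α ω : Fin n → ℂ)
    (hα : ∀ i, α i ∈ Metric.sphere (0:ℂ) 1) (hω : ∀ i, ω i ∈ Metric.sphere (0:ℂ) 1)
    (hαinj : Function.Injective α) (hωinj : Function.Injective ω)
    (hαω : ∀ i j, α i ≠ ω j)
    (hb₂ : ∀ i j : Fin n, i ≠ j →
      ∀ x ∈ Metric.sphere (0:ℂ) 1 \ {ω i, ω j}, ∃ k : Fin n,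
        α k ∈ connectedComponentIn (Metric.sphere (0:ℂ) 1 \ {ω i, ω j}) x)
    {z w : ℂ} (hz : z ∈ sphere (0:ℂ) 1) (hw : w ∈ sphere (0:ℂ) 1) :
    (Finset.univ.filter fun i => 0 ≤ ((z - α i) / (ω i - α i)).im).card ≤
    (Finset.univ.filter fun i => 0 < ((w - α i) / (ω i - α i)).im).card + 1 := by
  have h00 : (0:ℝ) ∈ Ico 0 (2 * Real.pi) := ⟨le_rfl, Real.two_pi_pos⟩
  have hw0 := sphere_ne_zero hw
  choose a haI haeq using fun i => exists_angle hw (hα i)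
  choose o hoI hoeq using fun i => exists_angle hw (hω i)
  obtain ⟨t, htI, hteq⟩ := exists_angle hw hz
  have hao : ∀ i j, a i ≠ o j := fun i j h => hαω i j (by rw [haeq, hoeq, h])
  have hainj : Function.Injective a := fun i j h => hαinj (by rw [haeq, haeq j, h])
  have hoinj : Function.Injective o := fun i j h => hωinj (by rw [hoeq, hoeq j, h])
  have sgz : ∀ i, SignType.sign (((z - α i) / (ω i - α i)).im) =
      SignType.sign ((o i - a i) * (t - o i) * (t - a i)) := fun i => by
    rw [haeq, hoeq, hteq]
    exact sign_im hw0 htI (haI i) (hoI i) (hao i i)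
  have sgw : ∀ i, SignType.sign (((w - α i) / (ω i - α i)).im) =
      SignType.sign ((o i - a i) * (0 - o i) * (0 - a i)) := fun i => by
    have := sign_im hw0 h00 (haI i) (hoI i) (hao i i)
    rw [← haeq, ← hoeq] at this
    simpa using this
  have cz : ∀ i, 0 ≤ ((z - α i) / (ω i - α i)).im ↔
      0 ≤ (o i - a i) * (t - o i) * (t - a i) := fun i => by
    rw [← sign_nonneg_iff, sgz, sign_nonneg_iff]
  have cw : ∀ i, 0 < ((w - α i) / (ω i - α i)).im ↔
      0 < (o i - a i) * (0 - o i) * (0 - a i) := fun i => by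
    rw [← sign_eq_one_iff, sgw, sign_eq_one_iff]
  -- positivity at `w`
  have cw' : ∀ i, 0 < a i → a i < o i → 0 < ((w - α i) / (ω i - α i)).im := fun i h1 h2 => by
    rw [cw]
    have := mul_pos (mul_pos (sub_pos.2 h2) (h1.trans h2)) h1
    linarith
  -- interleaving
  have hinter : ∀ i j, o i < o j → ∃ k, o i < a k ∧ a k < o j := by
    intro i j hij
    have hne : i ≠ j := by rintro rfl; exact lt_irrefl _ hij
    have hmI : (o i + o j) / 2 ∈ Ico 0 (2 * Real.pi) := by
      have := hoI i; have := hoI j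
      simp only [mem_Ico] at *
      constructor <;> linarith
    set m := (o i + o j) / 2 with hm
    have him : o i < m := by linarith
    have hmj : m < o j := by linarith
    have hs := sign_im hw0 hmI (hoI i) (hoI j) hij.ne
    rw [← hoeq, ← hoeq] at hs
    have hneg : ((w * exp (m * I) - ω i) / (ω j - ω i)).im < 0 := by
      rw [← sign_eq_neg_one_iff, hs, sign_eq_neg_one_iff]
      exact mul_neg_of_neg_of_pos (mul_neg_of_pos_of_neg (sub_pos.2 hij) (sub_neg.2 hmj))
        (sub_pos.2 him)
    have hx : w * exp (m * I) ∈ sphere (0:ℂ) 1 \ {ω i, ω j} := by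
      refine ⟨mem_sphere_exp hw m, ?_⟩
      rintro (h | h)
      · rw [h] at hneg; simp at hneg
      · rw [mem_singleton_iff] at h
        rw [h, div_self (sub_ne_zero.2 (hωinj.ne hne.symm))] at hneg; simp at hneg
    obtain ⟨k, hk⟩ := hb₂ i j hne _ hx
    have hk' := sign_comp (hω i) (hω j) (hωinj.ne hne) hx hk hneg
    have hs2 := sign_im hw0 (haI k) (hoI i) (hoI j) hij.ne
    rw [← hoeq, ← hoeq, ← haeq, sign_neg hk', eq_comm, sign_eq_neg_one_iff] at hs2
    refine ⟨k, ?_⟩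
    have h3 : (a k - o j) * (a k - o i) < 0 := by
      by_contra hcon
      push Not at hcon
      have := mul_nonneg (sub_pos.2 hij).le hcon
      linarith
    rcases mul_neg_iff.1 h3 with h | h
    · exfalso; linarith [h.1, h.2]
    · exact ⟨by linarith [h.2], by linarith [h.1]⟩
  rcases htI.1.eq_or_lt with ht | ht
  · -- `z = w`
    subst ht
    have hsub : (Finset.univ.filter fun i => 0 ≤ ((z - α i) / (ω i - α i)).im) ⊆
        (Finset.univ.filter fun i => 0 < ((w - α i) / (ω i - α i)).im) ∪
        (Finset.univ.filter fun i => a i = 0 ∨ o i = 0) := by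
      intro i hi
      simp only [Finset.mem_filter, Finset.mem_univ, true_and, Finset.mem_union] at hi ⊢
      rw [cz] at hi
      rw [cw]
      rcases hi.eq_or_lt with h | h
      · right
        have h := h.symm
        simp only [mul_eq_zero, sub_eq_zero] at h
        rcases h with (h | h) | h
        · exact absurd h.symm (hao i i)
        · exact Or.inr h.symm
        · exact Or.inl h.symm
      · exact Or.inl h
    have hone : (Finset.univ.filter fun i => a i = 0 ∨ o i = 0).card ≤ 1 := by
      by_contra hcon
      push Not at hcon
      obtain ⟨i, hi, j, hj, hij⟩ := Finset.one_lt_card.1 hcon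
      simp only [Finset.mem_filter, Finset.mem_univ, true_and] at hi hj
      rcases hi with hi | hi <;> rcases hj with hj | hj
      · exact hij (hainj (hi.trans hj.symm))
      · exact hao i j (hi.trans hj.symm)
      · exact hao j i (hj.trans hi.symm)
      · exact hij (hoinj (hi.trans hj.symm))
    calc _ ≤ _ := Finset.card_le_card hsub
      _ ≤ _ := Finset.card_union_le _ _
      _ ≤ _ := by omega
  · have hint : (Finset.univ.filter fun i => o i ≤ t).card ≤
        (Finset.univ.filter fun i => 0 < a i ∧ a i < t).card + 1 := by
      rw [← Finset.card_image_of_injective _ hoinj, ← Finset.card_image_of_injective _ hainj]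
      apply Finset.card_le_of_interleaved
      intro x hx y hy hxy _
      simp only [Finset.mem_image, Finset.mem_filter, Finset.mem_univ, true_and] at hx hy
      obtain ⟨i, hi, rfl⟩ := hx
      obtain ⟨j, hj, rfl⟩ := hy
      obtain ⟨k, hk1, hk2⟩ := hinter i j hxy
      refine ⟨a k, ?_, hk1, hk2⟩
      simp only [Finset.mem_image, Finset.mem_filter, Finset.mem_univ, true_and]
      exact ⟨k, ⟨(hoI i).1.trans_lt hk1, hk2.trans_le hj⟩, rfl⟩
    have hsum : (Finset.univ.filter fun i => 0 ≤ ((z - α i) / (ω i - α i)).im).card +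
        (Finset.univ.filter fun i => 0 < a i ∧ a i < t).card ≤
        (Finset.univ.filter fun i => 0 < ((w - α i) / (ω i - α i)).im).card +
        (Finset.univ.filter fun i => o i ≤ t).card := by
      simp only [Finset.card_filter]
      rw [← Finset.sum_add_distrib, ← Finset.sum_add_distrib]
      refine Finset.sum_le_sum fun i _ => ?_
      have ha0 := (haI i).1
      have ho0 := (hoI i).1
      rcases lt_or_gt_of_ne (hao i i) with h | h
      · -- `a < o`
        have hzz : 0 ≤ ((z - α i) / (ω i - α i)).im → t ≤ a i ∨ o i ≤ t := by
          intro h1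
          rw [cz] at h1
          by_contra hcon
          push Not at hcon
          have := mul_neg_of_neg_of_pos (mul_neg_of_pos_of_neg (sub_pos.2 h) (sub_neg.2 hcon.2))
            (sub_pos.2 hcon.1)
          linarith
        have hww := fun h' => cw' i h' h
        rcases ha0.eq_or_lt with h0 | h0
        · have : 0 ≤ ((z - α i) / (ω i - α i)).im → o i ≤ t := fun h1 => by
            rcases hzz h1 with h2 | h2 <;> linarith
          have h5 : ¬ 0 < a i := by linarith
          by_cases h1 : 0 ≤ ((z - α i) / (ω i - α i)).im
          · simp [h1, this h1, h5]
          · simp [h1, h5]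
        · have hww := hww h0
          by_cases h1 : 0 ≤ ((z - α i) / (ω i - α i)).im
          · rcases hzz h1 with h2 | h2
            · simp [h1, hww, not_lt.2 h2]
            · simp only [h1, hww, h2, if_true]; split_ifs <;> simp
          · simp only [h1, hww, if_true, if_false]; split_ifs <;> simp
      · -- `o < a`
        have hzz : 0 ≤ ((z - α i) / (ω i - α i)).im → t ≤ a i ∧ o i ≤ t := by
          intro h1
          rw [cz] at h1
          have h2 : (t - o i) * (t - a i) ≤ 0 := by
            by_contra hcon
            push Not at hcon
            have := mul_neg_of_neg_of_pos (sub_neg.2 h) hcon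
            linarith
          rcases mul_nonpos_iff.1 h2 with h3 | h3
          · exact ⟨by linarith [h3.2], by linarith [h3.1]⟩
          · exfalso; linarith [h3.1, h3.2]
        by_cases h1 : 0 ≤ ((z - α i) / (ω i - α i)).im
        · obtain ⟨h2, h3⟩ := hzz h1
          simp [h1, h3, not_lt.2 h2]
        · by_cases h4 : 0 < a i ∧ a i < t
          · simp [h1, h4, (h.trans h4.2).le]
          · simp [h1, h4]
    omega

/-- two points strictly on the same side are in the same component -/
lemma comp_of_side {a b x y : ℂ} (ha : a ∈ sphere (0:ℂ) 1) (hb : b ∈ sphere (0:ℂ) 1) (hab : a ≠ b)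
    (hx : x ∈ sphere (0:ℂ) 1) (hy : y ∈ sphere (0:ℂ) 1)
    (hxa : x ≠ a) (hxb : x ≠ b) (hya : y ≠ a) (hyb : y ≠ b)
    (h : y ∉ connectedComponentIn (sphere (0:ℂ) 1 \ {a, b}) x) :
    ((x - a) / (b - a)).im * ((y - a) / (b - a)).im < 0 := by
  have h00 : (0:ℝ) ∈ Ico 0 (2 * Real.pi) := ⟨le_rfl, Real.two_pi_pos⟩
  obtain ⟨o, ho, rfl⟩ := exists_angle ha hb
  obtain ⟨s, hs, rfl⟩ := exists_angle ha hx
  obtain ⟨t, ht, rfl⟩ := exists_angle ha hy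
  have ho0 : 0 ≠ o := by rintro rfl; simp at hab
  have hs0 : 0 ≠ s := by rintro rfl; simp at hxa
  have ht0 : 0 ≠ t := by rintro rfl; simp at hya
  have hso : s ≠ o := by rintro rfl; simp at hxb
  have hto : t ≠ o := by rintro rfl; simp at hyb
  have hop := lt_of_le_of_ne ho.1 ho0
  have hsp := lt_of_le_of_ne hs.1 hs0
  have htp := lt_of_le_of_ne ht.1 ht0
  have e1 := sign_im (sphere_ne_zero ha) hs h00 ho ho0
  have e2 := sign_im (sphere_ne_zero ha) ht h00 ho ho0
  simp only [ofReal_zero, zero_mul, Complex.exp_zero, mul_one, sub_zero] at e1 e2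
  -- an interval of angles avoiding the endpoints gives a connected arc
  have arc : ∀ J : Set ℝ, J ⊆ Ico 0 (2 * Real.pi) → 0 ∉ J → o ∉ J → IsPreconnected J →
      s ∈ J → t ∈ J → False := by
    intro J hJ h0 hoJ hpre hsJ htJ
    apply h
    have hcont : Continuous (fun r : ℝ => a * exp (r * I)) := by fun_prop
    have hp := hpre.image _ hcont.continuousOn
    refine hp.subset_connectedComponentIn (mem_image_of_mem _ hsJ) ?_ (mem_image_of_mem _ htJ)
    rintro _ ⟨r, hr, rfl⟩
    refine ⟨mem_sphere_exp ha r, ?_⟩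
    have e3 := sign_im (sphere_ne_zero ha) (hJ hr) h00 ho ho0
    simp only [ofReal_zero, zero_mul, Complex.exp_zero, mul_one, sub_zero] at e3
    have hr0 : r ≠ 0 := fun h' => h0 (h' ▸ hr)
    have hro : r ≠ o := fun h' => hoJ (h' ▸ hr)
    have hne : o * (r - o) * r ≠ 0 := mul_ne_zero (mul_ne_zero ho0.symm (sub_ne_zero.2 hro)) hr0
    rw [← sign_ne_zero, ← e3, sign_ne_zero] at hne
    rintro (h' | h')
    · apply hne
      simp only at h'
      rw [h']; simp
    · apply hne
      rw [mem_singleton_iff] at h'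
      simp only at h'
      rw [h', div_self (sub_ne_zero.2 hab.symm)]; simp
  rw [← sign_eq_neg_one_iff, sign_mul, e1, e2, ← sign_mul, sign_eq_neg_one_iff]
  have hpos : 0 < o * s * (o * t) := by positivity
  have hlt : (s - o) * (t - o) < 0 := by
    rw [mul_neg_iff]
    rcases lt_or_gt_of_ne hso with h1 | h1 <;> rcases lt_or_gt_of_ne hto with h2 | h2
    · exfalso
      exact arc (Ioo 0 o) (fun r hr => ⟨hr.1.le, hr.2.trans ho.2⟩) (by simp) (by simp)
        isPreconnected_Ioo ⟨hsp, h1⟩ ⟨htp, h2⟩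
    · right; constructor <;> linarith
    · left; constructor <;> linarith
    · exfalso
      exact arc (Ioo o (2 * Real.pi)) (fun r hr => ⟨ho.1.trans hr.1.le, hr.2⟩)
        (fun h' => absurd h'.1 (not_lt.2 ho.1)) (by simp)
        isPreconnected_Ioo ⟨h1, hs.2⟩ ⟨h2, ht.2⟩
  have := mul_neg_of_pos_of_neg hpos hlt
  linarith


/-- Claim proved in Remark (2) of the introduction. -/
theorem handel_remark_2 (n : ℕ) (hn : 2 ≤ n) (α ω : Fin n → ℂ)
    (hα : ∀ i, α i ∈ Metric.sphere (0:ℂ) 1) (hω : ∀ i, ω i ∈ Metric.sphere (0:ℂ) 1)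
    (hαinj : Function.Injective α) (hωinj : Function.Injective ω)
    (hαω : ∀ i j, α i ≠ ω j)
    (ha : ∀ i j k : Fin n, i ≠ j → i ≠ k → j ≠ k →
      lineThru (α i) (ω i) ∩ lineThru (α j) (ω j) ∩ lineThru (α k) (ω k) = ∅)
    (hb₁ : ∀ i j : Fin n, i ≠ j →
      ∀ x ∈ Metric.sphere (0:ℂ) 1 \ {α i, α j}, ∃ k : Fin n,
        ω k ∈ connectedComponentIn (Metric.sphere (0:ℂ) 1 \ {α i, α j}) x)
    (hb₂ : ∀ i j : Fin n, i ≠ j →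
      ∀ x ∈ Metric.sphere (0:ℂ) 1 \ {ω i, ω j}, ∃ k : Fin n,
        α k ∈ connectedComponentIn (Metric.sphere (0:ℂ) 1 \ {ω i, ω j}) x)
    (hc : ∀ i : Fin n, ∃ i' : Fin n, i' ≠ i ∧
      ω i ∉ connectedComponentIn (Metric.sphere (0:ℂ) 1 \ {α i', ω i'}) (α i)) :
    ∃ I : Set (Fin n), I.Nonempty ∧
      (((⋂ i ∈ I, halfPlanePos (α i) (ω i)).Nonempty ∧
          IsCompact (closure (⋂ i ∈ I, halfPlanePos (α i) (ω i))) ∧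
          closure (⋂ i ∈ I, halfPlanePos (α i) (ω i)) ⊆ Metric.ball (0:ℂ) 1) ∨
        ((⋂ i ∈ I, halfPlaneNeg (α i) (ω i)).Nonempty ∧
          IsCompact (closure (⋂ i ∈ I, halfPlaneNeg (α i) (ω i))) ∧
          closure (⋂ i ∈ I, halfPlaneNeg (α i) (ω i)) ⊆ Metric.ball (0:ℂ) 1)) := by
  classical
  set G : Fin n → ℂ → ℝ := fun k z => ((z - α k) / (ω k - α k)).im with hG
  have hd : ∀ k, ω k - α k ≠ 0 := fun k => sub_ne_zero.2 (hαω k k).symm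
  have hadd : ∀ k z v (r : ℝ), G k (z + r * v) = G k z + r * (v / (ω k - α k)).im := by
    intro k z v r
    simp only [hG]
    have : (z + r * v - α k) / (ω k - α k) =
        (z - α k) / (ω k - α k) + r * (v / (ω k - α k)) := by
      field_simp
      ring
    rw [this, add_im, im_ofReal_mul]
  have hline : ∀ k z, G k z = 0 → z ∈ lineThru (α k) (ω k) := by
    intro k z hz
    refine ⟨((z - α k) / (ω k - α k)).re, ?_⟩
    have h1 : ((((z - α k) / (ω k - α k)).re : ℝ) : ℂ) = (z - α k) / (ω k - α k) := by
      apply Complex.ext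
      · simp
      · rw [ofReal_im]; exact hz.symm
    rw [real_smul, h1, div_mul_cancel₀ _ (hd k)]
    ring
  -- two crossing chords
  let i : Fin n := ⟨0, by omega⟩
  obtain ⟨j, hji, hcomp⟩ := hc i
  have hAB := comp_of_side (hα j) (hω j) (hαω j j) (hα i) (hω i) (hαinj.ne hji.symm) (hαω i j)
    (hαω j i).symm (hωinj.ne hji.symm) hcomp
  have hAB : G j (α i) * G j (ω i) < 0 := hAB
  set A := G j (α i) with hA
  set B := G j (ω i) with hB
  have hBA : B = A + ((ω i - α i) / (ω j - α j)).im := by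
    have := hadd j (α i) (ω i - α i) 1
    simpa using this
  have hABne : A - B ≠ 0 := by
    intro h
    have : A = B := by linarith
    rw [this] at hAB
    nlinarith [mul_self_nonneg B]
  set Lji := ((ω i - α i) / (ω j - α j)).im with hLji
  set Lij := ((ω j - α j) / (ω i - α i)).im with hLij
  have hLji0 : Lji ≠ 0 := fun h => hABne (by rw [hBA, h]; ring)
  have hLij0 : Lij ≠ 0 := by
    rw [hLij, ← inv_div, inv_im]
    refine div_ne_zero (neg_ne_zero.2 hLji0) ?_
    exact (Complex.normSq_pos.2 (div_ne_zero (hd i) (hd j))).ne'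
  set s := A / (A - B) with hs
  have hs01 : 0 < s ∧ s < 1 := by
    rcases mul_neg_iff.1 hAB with h | h
    · have : 0 < A - B := by linarith [h.1, h.2]
      exact ⟨div_pos h.1 this, by rw [hs, div_lt_one this]; linarith [h.2]⟩
    · have : A - B < 0 := by linarith [h.1, h.2]
      exact ⟨div_pos_of_neg_of_neg h.1 this, by rw [hs, div_lt_one_of_neg this]; linarith [h.2]⟩
  set q : ℂ := α i + s * (ω i - α i) with hq
  have hGiq : G i q = 0 := by
    rw [hq, hadd, div_self (hd i)]
    simp [hG]
  have hGjq : G j q = 0 := by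
    rw [hq, hadd, ← hA, ← hLji]
    have : Lji = -(A - B) := by linarith
    rw [this, hs]
    field_simp
    ring
  have hqball : q ∈ ball (0:ℂ) 1 := by
    have h1 : q = (1 - s) • α i + s • ω i := by
      simp only [real_smul, hq]; push_cast; ring
    rw [mem_ball_zero_iff, h1]
    refine norm_combo_lt_of_ne (by simpa using (mem_sphere_zero_iff_norm.1 (hα i)).le)
      (by simpa using (mem_sphere_zero_iff_norm.1 (hω i)).le) (hαω i i) (by linarith [hs01.2])
      hs01.1 (by ring)
  have hGkq : ∀ k, k ≠ i → k ≠ j → G k q ≠ 0 := by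
    intro k hki hkj h0
    have := ha i j k hji.symm hki.symm hkj.symm
    have hmem : q ∈ lineThru (α i) (ω i) ∩ lineThru (α j) (ω j) ∩ lineThru (α k) (ω k) :=
      ⟨⟨hline i q hGiq, hline j q hGjq⟩, hline k q h0⟩
    rw [this] at hmem
    exact hmem
  set v : ℂ := Lij * (ω j - α j) + Lji * (ω i - α i) with hv
  have hvi : (v / (ω i - α i)).im = Lij * Lij := by
    rw [hv, add_div, mul_div_assoc, mul_div_assoc, div_self (hd i), add_im, im_ofReal_mul,
      im_ofReal_mul, ← hLij]
    simp
  have hvj : (v / (ω j - α j)).im = Lji * Lji := by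
    rw [hv, add_div, mul_div_assoc, mul_div_assoc, div_self (hd j), add_im, im_ofReal_mul,
      im_ofReal_mul, ← hLji]
    simp
  -- the index sets
  set J : Finset (Fin n) := Finset.univ.filter fun k => k ≠ i ∧ k ≠ j ∧ 0 < G k q with hJ
  have hiJ : i ∉ J := by simp [hJ]
  have hjJ : j ∉ insert i J := by simp [hJ, hji]
  have hev : ∀ᶠ e : ℝ in nhdsWithin 0 (Ioi 0), 0 < e ∧ q + (e : ℝ) * v ∈ ball (0:ℂ) 1 ∧
      q + ((-e : ℝ) : ℂ) * v ∈ ball (0:ℂ) 1 ∧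
      ∀ k, k ≠ i → k ≠ j → (0 < G k q → 0 < G k (q + (e : ℝ) * v)) ∧
        (G k q < 0 → G k (q + ((-e : ℝ) : ℂ) * v) < 0) := by
    have hc1 : Continuous fun e : ℝ => q + (e : ℂ) * v := by fun_prop
    have hc2 : Continuous fun e : ℝ => q + ((-e : ℝ) : ℂ) * v := by fun_prop
    have hGc : ∀ k, Continuous (G k) := fun k => by simp only [hG]; fun_prop
    refine Filter.Eventually.and self_mem_nhdsWithin ?_
    apply Filter.Eventually.filter_mono nhdsWithin_le_nhds
    refine Filter.Eventually.and ?_ (Filter.Eventually.and ?_ ?_)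
    · exact hc1.continuousAt.eventually_mem (isOpen_ball.mem_nhds (by simpa using hqball))
    · exact hc2.continuousAt.eventually_mem (isOpen_ball.mem_nhds (by simpa using hqball))
    · rw [Filter.eventually_all]
      intro k
      by_cases hk : 0 < G k q
      · have := ((hGc k).comp hc1).continuousAt.eventually_mem (x := 0)
          (isOpen_Ioi.mem_nhds (show G k (q + ((0:ℝ) : ℂ) * v) ∈ Ioi (0:ℝ) by simpa using hk))
        filter_upwards [this] with e he _ _
        exact ⟨fun _ => he, fun h => absurd h (not_lt.2 hk.le)⟩
      · by_cases hk' : G k q < 0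
        · have := ((hGc k).comp hc2).continuousAt.eventually_mem (x := 0)
            (isOpen_Iio.mem_nhds (show G k (q + ((-0:ℝ) : ℂ) * v) ∈ Iio (0:ℝ) by simpa using hk'))
          filter_upwards [this] with e he _ _
          exact ⟨fun h => absurd h hk, fun _ => he⟩
        · exact Filter.Eventually.of_forall fun e _ _ => ⟨fun h => absurd h hk, fun h => absurd h hk'⟩
  obtain ⟨e, he, hb1, hb2, hek⟩ := hev.exists
  by_cases hP : ∀ z ∈ sphere (0:ℂ) 1, ∃ k ∈ insert j (insert i J), G k z < 0
  · refine ⟨{k | k ∈ insert j (insert i J)}, ⟨j, by simp⟩, Or.inl ?_⟩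
    refine key_compact α ω _ (q + (e : ℝ) * v) hb1 ?_ hP
    intro k hk
    change 0 < G k _
    have hk : k ∈ insert j (insert i J) := hk
    simp only [Finset.mem_insert] at hk
    rcases hk with rfl | rfl | hk
    · rw [hadd, hGjq, hvj, zero_add]
      exact mul_pos he (mul_self_pos.2 hLji0)
    · rw [hadd, hGiq, hvi, zero_add]
      exact mul_pos he (mul_self_pos.2 hLij0)
    · simp only [hJ, Finset.mem_filter, Finset.mem_univ, true_and] at hk
      exact (hek k hk.1 hk.2.1).1 hk.2.2
  by_cases hN : ∀ z ∈ sphere (0:ℂ) 1, ∃ k, k ∉ J ∧ 0 < G k z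
  · refine ⟨{k | k ∉ J}, ⟨i, hiJ⟩, Or.inr ?_⟩
    have hpn : ∀ k, halfPlaneNeg (α k) (ω k) = halfPlanePos (ω k) (α k) :=
      fun k => halfPlaneNeg_eq (hαω k k)
    have hflip : ∀ k z, ((z - ω k) / (α k - ω k)).im = - G k z := by
      intro k z
      have h1 := hd k
      have h2 : α k - ω k ≠ 0 := sub_ne_zero.2 (hαω k k)
      have : (z - ω k) / (α k - ω k) = 1 - (z - α k) / (ω k - α k) := by
        rw [eq_sub_iff_add_eq, div_add_div _ _ h2 h1, div_eq_one_iff_eq (mul_ne_zero h2 h1)]; ring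
      rw [this]
      simp [hG]
    simp only [hpn]
    refine key_compact ω α _ (q + ((-e : ℝ) : ℂ) * v) hb2 ?_ ?_
    · intro k hk
      have hk : k ∉ J := hk
      rw [hflip, neg_pos]
      by_cases hki : k = i
      · subst hki
        rw [hadd, hGiq, hvi, zero_add]
        exact mul_neg_of_neg_of_pos (neg_lt_zero.2 he) (mul_self_pos.2 hLij0)
      by_cases hkj : k = j
      · subst hkj
        rw [hadd, hGjq, hvj, zero_add]
        exact mul_neg_of_neg_of_pos (neg_lt_zero.2 he) (mul_self_pos.2 hLji0)
      refine (hek k hki hkj).2 (lt_of_le_of_ne ?_ (hGkq k hki hkj))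
      by_contra hcon
      push Not at hcon
      exact hk (by simp [hJ, hki, hkj, hcon])
    · intro z hz
      obtain ⟨k, hk, hkz⟩ := hN z hz
      exact ⟨k, hk, by rw [hflip]; linarith⟩
  exfalso
  push Not at hP hN
  obtain ⟨z, hz, hzk⟩ := hP
  obtain ⟨w, hw, hwk⟩ := hN
  have hcount := count_le α ω hα hω hαinj hωinj hαω hb₂ hz hw
  have h1 : (insert j (insert i J)).card ≤
      (Finset.univ.filter fun i => 0 ≤ ((z - α i) / (ω i - α i)).im).card := by
    apply Finset.card_le_card
    intro k hk
    simpa using hzk k hk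
  have h2 : (Finset.univ.filter fun i => 0 < ((w - α i) / (ω i - α i)).im).card ≤ J.card := by
    apply Finset.card_le_card
    intro k hk
    by_contra hkJ
    have := hwk k hkJ
    simp only [Finset.mem_filter, Finset.mem_univ, true_and] at hk
    exact absurd hk (not_lt.2 this)
  rw [Finset.card_insert_of_notMem hjJ, Finset.card_insert_of_notMem hiJ] at h1
  have h3 := h1.trans (le_trans (by convert hcount) (Nat.add_le_add_right h2 1))
  omega
end
end
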